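/- Let β⃗ be sub-critical and fix an edge e of K_n. The function x ↦ ∂_e H(x) on 𝒢_n belongs to Lip(v) for a vector v whose entry at an edge f is O(1/n²) if f shares no vertex with e and O(1/n) if f shares a vertex with e; consequently ‖v‖_1 = O(1) and ‖v‖_∞ = O(1/n), and there exists a constant c > 0 such that for all sufficiently large n and all ε > 0, if X ~ ERGM(β⃗) then ℙ(|∂_e H(X) − 𝔼 ∂_e H(X)| > ε) ≤ 2 exp(−c n ε²). -/

import Mathlib

open Finset MeasureTheory Filter
open scoped ENNReal NNReal

namespace ERGM

/-- The set of edges of the complete graph on `Fin n`: non-diagonal unordered pairs. -/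
abbrev EdgeSet (n : ℕ) : Type := {p : Sym2 (Fin n) // ¬ p.IsDiag}

/-- A configuration (graph on `n` vertices): an assignment of `true/false` to each edge. -/
abbrev Config (n : ℕ) : Type := EdgeSet n → Bool

/-- The value of the configuration `x` on the (unordered) pair `{i,j}`; `false` for `i = j`. -/
noncomputable def edgeVal {n : ℕ} (x : Config n) (i j : Fin n) : Bool :=
  if h : (s(i, j) : Sym2 (Fin n)).IsDiag then false else x ⟨s(i, j), h⟩

/-- Real-valued indicator of presence of the edge `{i,j}` in `x`. -/
noncomputable def edgeInd {n : ℕ} (x : Config n) (i j : Fin n) : ℝ :=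
  if edgeVal x i j = true then 1 else 0

open scoped Classical in
/-- Subgraph counting number `N_G(x)`: the number of copies of `G` in `x` (times the
number of automorphisms), i.e. the sum over injective `ψ` of the product of edge
indicators (each edge indicator is idempotent, so counting ordered adjacent pairs
yields the same value as counting edges). -/
noncomputable def NG {n m : ℕ} (G : SimpleGraph (Fin m)) (x : Config n) : ℝ :=
  ∑ ψ : Fin m ↪ Fin n, ∏ a : Fin m, ∏ b : Fin m,
    if G.Adj a b then edgeInd x (ψ a) (ψ b) else 1

/-- The Hamiltonian `H(x) = Σ_i β_i N_{G_i}(x) / n^{|V_i|-2}`. -/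
noncomputable def Hamiltonian {n s : ℕ} (V : Fin s → ℕ)
    (G : ∀ i, SimpleGraph (Fin (V i))) (β : Fin s → ℝ) (x : Config n) : ℝ :=
  ∑ i, β i * NG (G i) x / (n : ℝ) ^ (V i - 2)

/-- The ERGM probability mass function `π(x) ∝ exp(H(x))`. -/
noncomputable def ergmProb {n s : ℕ} (V : Fin s → ℕ)
    (G : ∀ i, SimpleGraph (Fin (V i))) (β : Fin s → ℝ) (x : Config n) : ℝ :=
  Real.exp (Hamiltonian V G β x) / ∑ y : Config n, Real.exp (Hamiltonian V G β y)

/-- Expectation of `f` with respect to the mass function `w`. -/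
noncomputable def expect {n : ℕ} (w : Config n → ℝ) (f : Config n → ℝ) : ℝ :=
  ∑ x : Config n, w x * f x

open scoped Classical in
/-- Probability of the event `A` with respect to the mass function `w`. -/
noncomputable def prob {n : ℕ} (w : Config n → ℝ) (A : Config n → Prop) : ℝ :=
  ∑ x : Config n, if A x then w x else 0

/-- The number of edges `|E(G)|` of a finite graph. -/
noncomputable def numEdges {m : ℕ} (G : SimpleGraph (Fin m)) : ℕ := G.edgeSet.ncard

/-- `Ψ_β(p) = Σ_i 2 β_i |E_i| p^{|E_i|-1}`. -/
noncomputable def Psi {s : ℕ} (V : Fin s → ℕ) (G : ∀ i, SimpleGraph (Fin (V i)))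
    (β : Fin s → ℝ) (p : ℝ) : ℝ :=
  ∑ i, 2 * β i * (numEdges (G i) : ℝ) * p ^ (numEdges (G i) - 1)

/-- `Φ(u) = e^u / (1 + e^u)`. -/
noncomputable def Phi (u : ℝ) : ℝ := Real.exp u / (1 + Real.exp u)

/-- `φ_β(p) = Φ(Ψ_β(p))`. -/
noncomputable def phiFn {s : ℕ} (V : Fin s → ℕ) (G : ∀ i, SimpleGraph (Fin (V i)))
    (β : Fin s → ℝ) : ℝ → ℝ := fun p => Phi (Psi V G β p)

/-- `β` is sub-critical (high temperature) with fixed point `p`: `p` is the unique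
solution of `φ_β(p) = p` and it satisfies `φ_β'(p) < 1`. -/
def Subcritical {s : ℕ} (V : Fin s → ℕ) (G : ∀ i, SimpleGraph (Fin (V i)))
    (β : Fin s → ℝ) (p : ℝ) : Prop :=
  phiFn V G β p = p ∧ (∀ q : ℝ, phiFn V G β q = q → q = p) ∧
    deriv (phiFn V G β) p < 1

/-- The discrete derivative `∂_e H(x) = H(x_{e+}) - H(x_{e-})`. -/
noncomputable def dHam {n s : ℕ} (V : Fin s → ℕ) (G : ∀ i, SimpleGraph (Fin (V i)))
    (β : Fin s → ℝ) (e : EdgeSet n) (x : Config n) : ℝ :=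
  Hamiltonian V G β (Function.update x e true) - Hamiltonian V G β (Function.update x e false)

/-- Real-valued indicator `X_e` of presence of edge `e`. -/
noncomputable def edgeX {n : ℕ} (e : EdgeSet n) (x : Config n) : ℝ := if x e = true then 1 else 0

/-- Two edges of `K_n` share a vertex. -/
def ShareVertex {n : ℕ} (e f : EdgeSet n) : Prop := ∃ v : Fin n, v ∈ e.1 ∧ v ∈ f.1


/-- `f ∈ Lip(v)`: `|f(x) - f(y)| ≤ Σ_e v_e 1{x_e ≠ y_e}`. -/
def LipschitzVec {n : ℕ} (v : EdgeSet n → ℝ) (f : Config n → ℝ) : Prop :=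
  ∀ x y : Config n, |f x - f y| ≤ ∑ e : EdgeSet n, if x e ≠ y e then v e else 0

section Logistic

lemma Phi_pos (u : ℝ) : 0 < Phi u := by unfold Phi; positivity

lemma Phi_lt_one (u : ℝ) : Phi u < 1 := by
  unfold Phi
  rw [div_lt_one (by positivity)]
  linarith

lemma hasDerivAt_Phi (u : ℝ) : HasDerivAt Phi (Phi u * (1 - Phi u)) u := by
  have h := (Real.hasDerivAt_exp u).div ((Real.hasDerivAt_exp u).const_add 1)
    (by positivity : 1 + Real.exp u ≠ 0)
  refine HasDerivAt.congr_deriv (f := Phi) h ?_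
  have : 1 + Real.exp u ≠ 0 := by positivity
  unfold Phi
  field_simp

lemma Phi_strictMono : StrictMono Phi := by
  apply strictMono_of_deriv_pos
  intro u
  rw [(hasDerivAt_Phi u).deriv]
  exact mul_pos (Phi_pos u) (sub_pos.2 (Phi_lt_one u))

lemma continuous_Phi : Continuous Phi :=
  continuous_iff_continuousAt.2 fun u => (hasDerivAt_Phi u).continuousAt

lemma abs_Phi_sub_le {u v lo hi : ℝ} (hu : Phi u ∈ Set.Icc lo hi) (hv : Phi v ∈ Set.Icc lo hi) :
    |Phi u - Phi v| ≤ hi * (1 - lo) * |u - v| := by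
  have h := (convex_uIcc u v).norm_image_sub_le_of_norm_hasDerivWithin_le (f := Phi)
    (f' := fun t => Phi t * (1 - Phi t)) (C := hi * (1 - lo))
    (fun t _ => (hasDerivAt_Phi t).hasDerivWithinAt) ?_ Set.right_mem_uIcc Set.left_mem_uIcc
  · simpa [Real.norm_eq_abs] using h
  · intro t ht
    have h0 := Phi_pos t
    have h1 := Phi_lt_one t
    have hb : Phi t ∈ Set.Icc lo hi := by
      rcases Set.mem_uIcc.1 ht with h | h
      · exact ⟨hu.1.trans (Phi_strictMono.monotone h.1), (Phi_strictMono.monotone h.2).trans hv.2⟩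
      · exact ⟨hv.1.trans (Phi_strictMono.monotone h.1), (Phi_strictMono.monotone h.2).trans hu.2⟩
    rw [Real.norm_eq_abs, abs_of_nonneg (mul_nonneg h0.le (by linarith))]
    exact mul_le_mul hb.2 (by linarith [hb.1]) (by linarith) (h0.le.trans hb.2)

lemma abs_Phi_sub_le_abs (u v : ℝ) : |Phi u - Phi v| ≤ |u - v| := by
  have h := abs_Phi_sub_le (lo := 0) (hi := 1) ⟨(Phi_pos u).le, (Phi_lt_one u).le⟩
    ⟨(Phi_pos v).le, (Phi_lt_one v).le⟩
  simpa using h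

lemma exp_le_add_exp_sq (y : ℝ) : Real.exp y ≤ y + Real.exp (y ^ 2) := by
  have h2 := Real.add_one_le_exp (y ^ 2)
  rcases le_or_gt |y| 1 with h | h
  · have := (abs_le.1 (Real.abs_exp_sub_one_sub_id_le h)).2
    linarith
  · rcases lt_abs.1 h with h | h
    · have : Real.exp y ≤ Real.exp (y ^ 2) := Real.exp_le_exp.2 (by nlinarith)
      linarith
    · have : Real.exp y ≤ 1 := Real.exp_le_one_iff.2 (by linarith)
      nlinarith

/-- A two-point form of Hoeffding's lemma. -/
lemma two_point_exp_le {q : ℝ} (h0 : 0 ≤ q) (h1 : q ≤ 1) (A B : ℝ) :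
    q * Real.exp A + (1 - q) * Real.exp B
      ≤ Real.exp (q * A + (1 - q) * B + (A - B) ^ 2) := by
  set m := q * A + (1 - q) * B with hm
  set D := A - B with hD
  have hA : A = m + (1 - q) * D := by rw [hm, hD]; ring
  have hB : B = m + (-q * D) := by rw [hm, hD]; ring
  have e1 := exp_le_add_exp_sq ((1 - q) * D)
  have e2 := exp_le_add_exp_sq (-q * D)
  have f1 : Real.exp (((1 - q) * D) ^ 2) ≤ Real.exp (D ^ 2) :=
    Real.exp_le_exp.2 (by rw [mul_pow]; nlinarith [sq_nonneg D])
  have f2 : Real.exp ((-q * D) ^ 2) ≤ Real.exp (D ^ 2) :=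
    Real.exp_le_exp.2 (by rw [mul_pow]; nlinarith [sq_nonneg D])
  have key : q * Real.exp ((1 - q) * D) + (1 - q) * Real.exp (-q * D) ≤ Real.exp (D ^ 2) := by
    have g1 := mul_le_mul_of_nonneg_left (e1.trans (add_le_add_right f1 _)) h0
    have g2 := mul_le_mul_of_nonneg_left (e2.trans (add_le_add_right f2 _)) (sub_nonneg.2 h1)
    nlinarith
  calc q * Real.exp A + (1 - q) * Real.exp B
      = Real.exp m * (q * Real.exp ((1 - q) * D) + (1 - q) * Real.exp (-q * D)) := by
        rw [mul_add, mul_left_comm, mul_left_comm (Real.exp m), ← Real.exp_add, ← Real.exp_add,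
          ← hA, ← hB]
    _ ≤ Real.exp m * Real.exp (D ^ 2) := mul_le_mul_of_nonneg_left key (Real.exp_pos m).le
    _ = Real.exp (m + D ^ 2) := (Real.exp_add _ _).symm

end Logistic

section Spin

/-- The value of a Boolean as a real number in `{0, 1}`. -/
def spin (b : Bool) : ℝ := if b = true then 1 else 0

@[simp] lemma spin_true : spin true = 1 := rfl

@[simp] lemma spin_false : spin false = 0 := by simp [spin]

lemma spin_nonneg (b : Bool) : 0 ≤ spin b := by cases b <;> simp

lemma spin_le_one (b : Bool) : spin b ≤ 1 := by cases b <;> simp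

end Spin

section Configurations

variable {ι : Type*} [DecidableEq ι]

/-- The discrete derivative of `f` in the coordinate `a`. -/
def ddiff (a : ι) (f : (ι → Bool) → ℝ) (x : ι → Bool) : ℝ :=
  f (Function.update x a true) - f (Function.update x a false)

/-- Resampling the coordinate `a`, which becomes `true` with probability `r`. -/
def resample (r : ℝ) (a : ι) (f : (ι → Bool) → ℝ) (x : ι → Bool) : ℝ :=
  r * f (Function.update x a true) + (1 - r) * f (Function.update x a false)

/-- Resampling all the coordinates in a list, independently with the same probability `q`. -/
def resampleList (q : ℝ) (l : List ι) (f : (ι → Bool) → ℝ) : (ι → Bool) → ℝ :=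
  l.foldr (fun a g => resample q a g) f

lemma ddiff_update (a : ι) (f : (ι → Bool) → ℝ) (x : ι → Bool) (b : Bool) :
    ddiff a f (Function.update x a b) = ddiff a f x := by
  simp [ddiff]

lemma resample_mono {q : ℝ} (h0 : 0 ≤ q) (h1 : q ≤ 1) (a : ι) {f g : (ι → Bool) → ℝ}
    (h : ∀ x, f x ≤ g x) (x : ι → Bool) : resample q a f x ≤ resample q a g x :=
  add_le_add (mul_le_mul_of_nonneg_left (h _) h0)
    (mul_le_mul_of_nonneg_left (h _) (sub_nonneg.2 h1))

lemma resample_const (q : ℝ) (a : ι) (k : ℝ) : resample q a (fun _ => k) = fun _ => k := by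
  funext x; simp only [resample]; ring

lemma resampleList_mono {q : ℝ} (h0 : 0 ≤ q) (h1 : q ≤ 1) (l : List ι) {f g : (ι → Bool) → ℝ}
    (h : ∀ x, f x ≤ g x) (x : ι → Bool) : resampleList q l f x ≤ resampleList q l g x := by
  induction l generalizing x with
  | nil => exact h x
  | cons a l ih => exact resample_mono h0 h1 a ih x

lemma resampleList_const (q : ℝ) (l : List ι) (k : ℝ) :
    resampleList q l (fun _ => k) = fun _ => k := by
  induction l with
  | nil => rfl
  | cons a l ih => exact (congrArg (resample q a) ih).trans (resample_const q a k)

lemma resampleList_sum {J : Type*} (q : ℝ) (l : List ι) (s : Finset J) (c : J → ℝ)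
    (f : J → (ι → Bool) → ℝ) (x : ι → Bool) :
    resampleList q l (fun x => ∑ j ∈ s, c j * f j x) x
      = ∑ j ∈ s, c j * resampleList q l (f j) x := by
  induction l generalizing x with
  | nil => rfl
  | cons a l ih =>
    change resample q a (resampleList q l _) x = ∑ j ∈ s, c j * resample q a (resampleList q l _) x
    simp only [resample, ih, Finset.mul_sum, ← Finset.sum_add_distrib]
    exact Finset.sum_congr rfl fun j _ => by ring

lemma ddiff_resample_of_ne {a b : ι} (hab : a ≠ b) (q : ℝ) (f : (ι → Bool) → ℝ) (x : ι → Bool) :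
    ddiff a (resample q b f) x = resample q b (ddiff a f) x := by
  simp only [ddiff, resample, Function.update_comm hab]
  ring

lemma ddiff_resample_self (a : ι) (q : ℝ) (f : (ι → Bool) → ℝ) (x : ι → Bool) :
    ddiff a (resample q a f) x = 0 := by
  simp [ddiff, resample]

/-- If `ddiff a f` takes values in a convex set containing `0`, then so does
`ddiff a (resampleList q l f)`. -/
lemma ddiff_resampleList_mem {q : ℝ} (h0 : 0 ≤ q) (h1 : q ≤ 1) (l : List ι) {s : Set ℝ}
    (hs : Convex ℝ s) (hs0 : (0 : ℝ) ∈ s) {f : (ι → Bool) → ℝ} {a : ι}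
    (h : ∀ x, ddiff a f x ∈ s) (x : ι → Bool) : ddiff a (resampleList q l f) x ∈ s := by
  induction l generalizing x with
  | nil => exact h x
  | cons b l ih =>
    change ddiff a (resample q b (resampleList q l f)) x ∈ s
    by_cases hab : a = b
    · subst hab
      rw [ddiff_resample_self]; exact hs0
    · rw [ddiff_resample_of_ne hab]
      exact hs (ih _) (ih _) h0 (sub_nonneg.2 h1) (by ring)

/-- Exponential moments of functions with bounded differences under a product measure. -/
lemma resampleList_exp_le {q : ℝ} (h0 : 0 ≤ q) (h1 : q ≤ 1) (l : List ι)
    {g : (ι → Bool) → ℝ} {d : ι → ℝ} (hg : ∀ a x, |ddiff a g x| ≤ d a) (x : ι → Bool) :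
    resampleList q l (fun x => Real.exp (g x)) x
      ≤ Real.exp (resampleList q l g x + (l.map fun a => d a ^ 2).sum) := by
  induction l generalizing x with
  | nil => simp [resampleList]
  | cons a l ih =>
    change resample q a (resampleList q l _) x
      ≤ Real.exp (resample q a (resampleList q l g) x + _)
    set s := (l.map fun a => d a ^ 2).sum
    refine (resample_mono h0 h1 a ih x).trans ?_
    have hd : |ddiff a (resampleList q l g) x| ≤ d a := by
      have := ddiff_resampleList_mem h0 h1 l (s := Set.Icc (-d a) (d a)) (convex_Icc _ _)
        (by have := (abs_nonneg _).trans (hg a x); constructor <;> linarith)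
        (fun y => abs_le.1 (hg a y)) x
      exact abs_le.2 this
    refine (two_point_exp_le h0 h1 _ _).trans (Real.exp_le_exp.2 ?_)
    have h3 : (ddiff a (resampleList q l g) x) ^ 2 ≤ d a ^ 2 := sq_le_sq' (abs_le.1 hd).1 (abs_le.1 hd).2
    simp only [ddiff] at h3
    simp only [resample, List.map_cons, List.sum_cons]
    nlinarith

end Configurations

section Measure

variable {ι : Type*} [Fintype ι] [DecidableEq ι]

/-- The expectation of `f` with respect to the mass function `w`. -/
def mean (w f : (ι → Bool) → ℝ) : ℝ := ∑ x, w x * f x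

/-- The Gibbs measure with energy `U`. -/
noncomputable def gibbs (U : (ι → Bool) → ℝ) (x : ι → Bool) : ℝ :=
  Real.exp (U x) / ∑ y, Real.exp (U y)

/-- The conditional probability, under the Gibbs measure, that the coordinate `a` is `true`. -/
noncomputable def rate (U : (ι → Bool) → ℝ) (a : ι) (x : ι → Bool) : ℝ := Phi (ddiff a U x)

lemma gibbs_pos (U : (ι → Bool) → ℝ) (x : ι → Bool) : 0 < gibbs U x :=
  div_pos (Real.exp_pos _) (Finset.sum_pos (fun _ _ => Real.exp_pos _) Finset.univ_nonempty)

lemma gibbs_sum (U : (ι → Bool) → ℝ) : ∑ x, gibbs U x = 1 := by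
  unfold gibbs
  rw [← Finset.sum_div]
  exact div_self (Finset.sum_pos (fun _ _ => Real.exp_pos _) Finset.univ_nonempty).ne'

lemma sum_update_add (a : ι) (g : (ι → Bool) → ℝ) :
    ∑ x, (g (Function.update x a true) + g (Function.update x a false)) = 2 * ∑ x, g x := by
  have h : ∀ x, g (Function.update x a true) + g (Function.update x a false)
      = g x + g (Function.update x a (!x a)) := by
    intro x
    cases hx : x a
    · rw [← hx, Function.update_eq_self, hx, add_comm]; rfl
    · rw [← hx, Function.update_eq_self, hx]; rfl
  have hinv : Function.Involutive fun x : ι → Bool => Function.update x a (!x a) := by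
    intro x; simp
  simp_rw [h]
  rw [Finset.sum_add_distrib, two_mul]
  congr 1
  exact Equiv.sum_comp hinv.toPerm g

/-- Gibbs measures are invariant under resampling a coordinate given the others. -/
lemma mean_resample_rate (U : (ι → Bool) → ℝ) (a : ι) (f : (ι → Bool) → ℝ) :
    mean (gibbs U) (fun x => resample (rate U a x) a f x) = mean (gibbs U) f := by
  have key : ∀ g : (ι → Bool) → ℝ, mean (gibbs U) g
      = (∑ x, Real.exp (U x) * g x) / ∑ y, Real.exp (U y) := by
    intro g
    simp only [mean, gibbs, Finset.sum_div]
    exact Finset.sum_congr rfl fun x _ => by ring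
  rw [key, key]
  congr 1
  have h2 : (2 : ℝ) ≠ 0 := two_ne_zero
  apply mul_left_cancel₀ h2
  rw [← sum_update_add a, ← sum_update_add a]
  refine Finset.sum_congr rfl fun x _ => ?_
  simp only [rate, ddiff_update, resample, Function.update_idem]
  have : Phi (ddiff a U x) = Real.exp (U (Function.update x a true)) /
      (Real.exp (U (Function.update x a false)) + Real.exp (U (Function.update x a true))) := by
    rw [Phi, ddiff, Real.exp_sub]
    field_simp
  rw [this]
  field_simp
  ring

variable {w : (ι → Bool) → ℝ}

lemma mean_mono (hw : ∀ x, 0 ≤ w x) {f g : (ι → Bool) → ℝ} (h : ∀ x, f x ≤ g x) :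
    mean w f ≤ mean w g :=
  Finset.sum_le_sum fun x _ => mul_le_mul_of_nonneg_left (h x) (hw x)

lemma mean_add (f g : (ι → Bool) → ℝ) :
    mean w (fun x => f x + g x) = mean w f + mean w g := by
  simp only [mean, mul_add, Finset.sum_add_distrib]

lemma mean_const_mul (k : ℝ) (f : (ι → Bool) → ℝ) :
    mean w (fun x => k * f x) = k * mean w f := by
  simp only [mean, Finset.mul_sum]
  exact Finset.sum_congr rfl fun x _ => by ring

lemma mean_const (hw : ∑ x, w x = 1) (k : ℝ) : mean w (fun _ => k) = k := by
  simp only [mean, ← Finset.sum_mul, hw, one_mul]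

lemma mean_sum {J : Type*} (s : Finset J) (f : J → (ι → Bool) → ℝ) :
    mean w (fun x => ∑ j ∈ s, f j x) = ∑ j ∈ s, mean w (f j) := by
  simp only [mean, Finset.mul_sum]
  exact Finset.sum_comm

lemma abs_mean_le (hw : ∀ x, 0 ≤ w x) (hw1 : ∑ x, w x = 1) {f : (ι → Bool) → ℝ} {L : ℝ}
    (h : ∀ x, |f x| ≤ L) : |mean w f| ≤ L := by
  refine abs_le.2 ⟨?_, ?_⟩
  · rw [← mean_const hw1 (-L)]
    exact mean_mono hw fun x => (abs_le.1 (h x)).1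
  · rw [← mean_const hw1 L]
    exact mean_mono hw fun x => (abs_le.1 (h x)).2

/-- Stochastic comparison with a product measure: if the conditional probabilities are on the
correct side of `q` outside a set with indicator `bad`, then the expectation of a monotone (for
`σ = 1`) or antitone (for `σ = -1`) function is at most its expectation under the product measure,
up to the probability of `bad` times the number of resampled coordinates. -/
lemma mean_le_mean_resampleList (U : (ι → Bool) → ℝ) {q σ : ℝ} (h0 : 0 ≤ q) (h1 : q ≤ 1)
    (hσ : σ ^ 2 = 1) {bad : (ι → Bool) → ℝ} (hbad : ∀ x, 0 ≤ bad x)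
    (hrate : ∀ a x, σ * (rate U a x - q) ≤ 0 ∨ bad x = 1)
    {f : (ι → Bool) → ℝ} (hf0 : ∀ x, 0 ≤ f x) (hf1 : ∀ x, f x ≤ 1)
    (hmono : ∀ a x, 0 ≤ σ * ddiff a f x) (l : List ι) :
    mean (gibbs U) f ≤ mean (gibbs U) (resampleList q l f) + l.length * mean (gibbs U) bad := by
  induction l with
  | nil => simp [resampleList]
  | cons a l ih =>
    set g := resampleList q l f with hg
    have hg0 : ∀ x, 0 ≤ g x := fun x => by
      have := resampleList_mono h0 h1 l (f := fun _ => 0) hf0 x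
      rwa [resampleList_const] at this
    have hg1 : ∀ x, g x ≤ 1 := fun x => by
      have := resampleList_mono h0 h1 l (g := fun _ => 1) hf1 x
      rwa [resampleList_const] at this
    have hgm : ∀ x, 0 ≤ σ * ddiff a g x := fun x =>
      ddiff_resampleList_mem h0 h1 l (s := {t | 0 ≤ σ * t})
        ((convex_Ici (0 : ℝ)).linear_preimage (LinearMap.mulLeft ℝ σ)) (by simp) (hmono a) x
    have step : mean (gibbs U) g ≤ mean (gibbs U) (resample q a g) + mean (gibbs U) bad := by
      rw [← mean_resample_rate U a g, ← mean_add]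
      refine mean_mono (fun x => (gibbs_pos U x).le) fun x => ?_
      have e : resample (rate U a x) a g x - resample q a g x = (rate U a x - q) * ddiff a g x := by
        simp only [resample, ddiff]; ring
      rcases hrate a x with h | h
      · have : (rate U a x - q) * ddiff a g x ≤ 0 := by
          have h3 : (rate U a x - q) * ddiff a g x
              = (σ * (rate U a x - q)) * (σ * ddiff a g x) := by
            linear_combination (-(rate U a x - q) * ddiff a g x) * hσ
          rw [h3]
          exact mul_nonpos_of_nonpos_of_nonneg h (hgm x)
        linarith [hbad x]
      · have r0 : 0 ≤ rate U a x := (Phi_pos _).le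
        have r1 : rate U a x ≤ 1 := (Phi_lt_one _).le
        have t1 : resample (rate U a x) a g x ≤ 1 := by
          have := resample_mono r0 r1 a hg1 x
          rwa [resample_const] at this
        have t2 : 0 ≤ resample q a g x := by
          have := resample_mono h0 h1 a hg0 x
          rwa [resample_const] at this
        linarith
    change _ ≤ mean (gibbs U) (resample q a g) + _
    rw [List.length_cons]
    push_cast
    linarith

end Measure

section Polynomial

variable {ι J : Type*} [DecidableEq ι]

/-- The monomial `∏_{b ∈ T} x_b`. -/
def monom (T : Finset ι) (x : ι → Bool) : ℝ := ∏ b ∈ T, spin (x b)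

omit [DecidableEq ι] in
lemma monom_nonneg (T : Finset ι) (x : ι → Bool) : 0 ≤ monom T x :=
  Finset.prod_nonneg fun _ _ => spin_nonneg _

omit [DecidableEq ι] in
lemma monom_le_one (T : Finset ι) (x : ι → Bool) : monom T x ≤ 1 :=
  Finset.prod_le_one (fun _ _ => spin_nonneg _) fun _ _ => spin_le_one _

lemma monom_update_of_notMem {T : Finset ι} {a : ι} (ha : a ∉ T) (x : ι → Bool) (b : Bool) :
    monom T (Function.update x a b) = monom T x :=
  Finset.prod_congr rfl fun c hc => by
    rw [Function.update_of_ne (ne_of_mem_of_not_mem hc ha)]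

lemma monom_update_of_mem {T : Finset ι} {a : ι} (ha : a ∈ T) (x : ι → Bool) (b : Bool) :
    monom T (Function.update x a b) = spin b * monom (T.erase a) x := by
  rw [monom, ← Finset.mul_prod_erase _ _ ha, Function.update_self]
  exact congrArg _ (monom_update_of_notMem (Finset.notMem_erase a T) x b)

lemma ddiff_monom (T : Finset ι) (a : ι) (x : ι → Bool) :
    ddiff a (monom T) x = if a ∈ T then monom (T.erase a) x else 0 := by
  split_ifs with h
  · simp [ddiff, monom_update_of_mem h]
  · simp [ddiff, monom_update_of_notMem h]

lemma resampleList_monom (q : ℝ) {l : List ι} (hl : l.Nodup) (T : Finset ι) (x : ι → Bool) :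
    resampleList q l (monom T) x = ∏ b ∈ T, if b ∈ l then q else spin (x b) := by
  induction l generalizing x with
  | nil => simp [resampleList, monom]
  | cons a l ih =>
    obtain ⟨ha, hl⟩ := List.nodup_cons.1 hl
    change resample q a (resampleList q l (monom T)) x = _
    have hrest : ∀ S : Finset ι, a ∉ S → ∀ b, (∏ c ∈ S, if c ∈ l then q
        else spin (Function.update x a b c)) = ∏ c ∈ S, if c ∈ a :: l then q else spin (x c) := by
      intro S hS b
      refine Finset.prod_congr rfl fun c hc => ?_
      have hne := ne_of_mem_of_not_mem hc hS
      simp [hne]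
    simp only [resample, ih hl]
    by_cases haT : a ∈ T
    · rw [← Finset.mul_prod_erase T _ haT, ← Finset.mul_prod_erase T _ haT,
        ← Finset.mul_prod_erase T _ haT, hrest _ (Finset.notMem_erase a T),
        hrest _ (Finset.notMem_erase a T)]
      simp [ha]
    · rw [hrest _ haT, hrest _ haT]
      ring

lemma resampleList_affine (q : ℝ) (l : List ι) (f : (ι → Bool) → ℝ) (k m : ℝ) (x : ι → Bool) :
    resampleList q l (fun x => k * f x + m) x = k * resampleList q l f x + m := by
  induction l generalizing x with
  | nil => rfl
  | cons a l ih =>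
    change resample q a (resampleList q l _) x = k * resample q a (resampleList q l _) x + m
    simp only [resample, ih]
    ring

variable [Fintype J]

/-- The multilinear polynomial with coefficients `c j` and monomials `T j`. -/
def energy (c : J → ℝ) (T : J → Finset ι) (x : ι → Bool) : ℝ := ∑ j, c j * monom (T j) x

/-- The discrete derivative of `energy c T` at `a`, as a polynomial. -/
def localField (c : J → ℝ) (T : J → Finset ι) (a : ι) (x : ι → Bool) : ℝ :=
  ∑ j with a ∈ T j, c j * monom ((T j).erase a) x

/-- The total coefficient of the monomials that contain both `a` and `b`. -/
def infl (c : J → ℝ) (T : J → Finset ι) (a b : ι) : ℝ := ∑ j with a ∈ T j ∧ b ∈ T j, c j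

lemma ddiff_energy (c : J → ℝ) (T : J → Finset ι) (a : ι) (x : ι → Bool) :
    ddiff a (energy c T) x = localField c T a x := by
  have : ddiff a (energy c T) x = ∑ j, c j * ddiff a (monom (T j)) x := by
    simp only [ddiff, energy, mul_sub, Finset.sum_sub_distrib]
  rw [this, localField, Finset.sum_filter]
  refine Finset.sum_congr rfl fun j _ => ?_
  rw [ddiff_monom]
  split_ifs <;> simp

lemma ddiff_localField (c : J → ℝ) (T : J → Finset ι) (a b : ι) (x : ι → Bool) :
    ddiff b (localField c T a) x
      = ∑ j with a ∈ T j, c j * ddiff b (monom ((T j).erase a)) x := by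
  simp only [ddiff, localField, mul_sub, Finset.sum_sub_distrib]

variable {c : J → ℝ} {T : J → Finset ι}

lemma infl_nonneg (hc : ∀ j, 0 ≤ c j) (a b : ι) : 0 ≤ infl c T a b :=
  Finset.sum_nonneg fun j _ => hc j

lemma ddiff_localField_nonneg (hc : ∀ j, 0 ≤ c j) (a b : ι) (x : ι → Bool) :
    0 ≤ ddiff b (localField c T a) x := by
  rw [ddiff_localField]
  refine Finset.sum_nonneg fun j _ => mul_nonneg (hc j) ?_
  rw [ddiff_monom]
  split_ifs
  exacts [monom_nonneg _ _, le_rfl]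

lemma ddiff_localField_self (a : ι) (x : ι → Bool) : ddiff a (localField c T a) x = 0 := by
  rw [ddiff_localField]
  refine Finset.sum_eq_zero fun j _ => ?_
  rw [ddiff_monom, if_neg (Finset.notMem_erase a _), mul_zero]

lemma ddiff_localField_le (hc : ∀ j, 0 ≤ c j) {a b : ι} (x : ι → Bool) :
    ddiff b (localField c T a) x ≤ infl c T a b := by
  rw [ddiff_localField, infl, ← Finset.filter_filter, Finset.sum_filter (p := fun j => b ∈ T j)]
  refine Finset.sum_le_sum fun j _ => ?_
  rw [ddiff_monom]
  split_ifs with h1 h2 h2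
  · exact mul_le_of_le_one_right (hc j) (monom_le_one _ _)
  · exact absurd (Finset.mem_of_mem_erase h1) h2
  · simpa using hc j
  · simp

lemma localField_nonneg (hc : ∀ j, 0 ≤ c j) (a : ι) (x : ι → Bool) : 0 ≤ localField c T a x :=
  Finset.sum_nonneg fun j _ => mul_nonneg (hc j) (monom_nonneg _ _)

lemma localField_le (hc : ∀ j, 0 ≤ c j) (a : ι) (x : ι → Bool) :
    localField c T a x ≤ infl c T a a := by
  simp only [infl, and_self]
  exact Finset.sum_le_sum fun j _ => mul_le_of_le_one_right (hc j) (monom_le_one _ _)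

variable [Fintype ι]

lemma resampleList_localField (q : ℝ) (a : ι) (x : ι → Bool) :
    resampleList q Finset.univ.toList (localField c T a) x
      = ∑ j with a ∈ T j, c j * q ^ ((T j).card - 1) := by
  unfold localField
  rw [resampleList_sum]
  refine Finset.sum_congr rfl fun j hj => ?_
  rw [resampleList_monom q (Finset.nodup_toList _)]
  simp [Finset.card_erase_of_mem (Finset.mem_filter.1 hj).2]

/-- Uniform bounds on a polynomial Hamiltonian with nonnegative coefficients on `≍ r²` spins, whose
local fields at density `q` are close to `Ψ q`. -/
structure Regular (c : J → ℝ) (T : J → Finset ι) (Ψ dΨ : ℝ → ℝ) (K r : ℝ) : Prop where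
  coeff_nonneg : ∀ j, 0 ≤ c j
  card_le : ∀ j, ((T j).card : ℝ) ≤ K
  card_index_le : (Fintype.card ι : ℝ) ≤ r ^ 2
  weight_le : ∀ a, infl c T a a ≤ K
  infl_le : ∀ a b, a ≠ b → infl c T a b ≤ K / r
  profile_le : ∀ a, ∀ q ∈ Set.Icc (0 : ℝ) 1,
    ∑ j with a ∈ T j, c j * q ^ ((T j).card - 1) ≤ Ψ q
  le_profile : ∀ a, ∀ q ∈ Set.Icc (0 : ℝ) 1,
    Ψ q - K / r ≤ ∑ j with a ∈ T j, c j * q ^ ((T j).card - 1)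
  slope_le : ∀ a, ∀ q ∈ Set.Icc (0 : ℝ) 1,
    ∑ j with a ∈ T j, c j * (((T j).card - 1 : ℕ) * q ^ ((T j).card - 1 - 1)) ≤ dΨ q

variable {Ψ dΨ : ℝ → ℝ} {K r : ℝ}

lemma Regular.sum_infl_le (H : Regular c T Ψ dΨ K r) (a : ι) : ∑ b, infl c T a b ≤ K ^ 2 := by
  have h1 : ∑ b, infl c T a b = ∑ j with a ∈ T j, c j * (T j).card := by
    simp only [infl, ← Finset.filter_filter]
    simp_rw [Finset.sum_filter (p := fun j => _ ∈ T j) (s := {j | a ∈ T j})]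
    rw [Finset.sum_comm]
    refine Finset.sum_congr rfl fun j _ => ?_
    simp [mul_comm]
  rw [h1, sq]
  have hK : 0 ≤ K := (infl_nonneg H.coeff_nonneg a a).trans (H.weight_le a)
  calc ∑ j with a ∈ T j, c j * (T j).card ≤ ∑ j with a ∈ T j, c j * K :=
        Finset.sum_le_sum fun j _ => mul_le_mul_of_nonneg_left (H.card_le j) (H.coeff_nonneg j)
    _ = infl c T a a * K := by rw [← Finset.sum_mul]; simp [infl]
    _ ≤ K * K := mul_le_mul_of_nonneg_right (H.weight_le a) hK

/-- The energy with an additional external field `h`. -/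
def energyField (c : J → ℝ) (T : J → Finset ι) (h : ι → ℝ) (x : ι → Bool) : ℝ :=
  energy c T x + ∑ a, h a * spin (x a)

lemma ddiff_linear (h : ι → ℝ) (a : ι) (x : ι → Bool) :
    ddiff a (fun x => ∑ b, h b * spin (x b)) x = h a := by
  simp only [ddiff, ← Finset.sum_sub_distrib, ← mul_sub]
  rw [Finset.sum_eq_single a]
  · simp
  · intro b _ hb
    simp [Function.update_of_ne hb]
  · simp

lemma rate_energyField (h : ι → ℝ) (a : ι) (x : ι → Bool) :
    rate (energyField c T h) a x = Phi (localField c T a x + h a) := by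
  rw [rate]
  congr 1
  rw [← ddiff_energy, ← ddiff_linear h a x]
  simp only [ddiff, energyField]
  ring

open scoped Classical in
/-- The indicator function of an event. -/
noncomputable def ind (P : (ι → Bool) → Prop) (x : ι → Bool) : ℝ := if P x then 1 else 0

omit [Fintype ι] [DecidableEq ι] in
lemma ind_nonneg (P : (ι → Bool) → Prop) (x : ι → Bool) : 0 ≤ ind P x := by
  unfold ind; split_ifs <;> simp

omit [Fintype ι] [DecidableEq ι] in
lemma ind_le_one (P : (ι → Bool) → Prop) (x : ι → Bool) : ind P x ≤ 1 := by
  unfold ind; split_ifs <;> simp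

omit [Fintype ι] [DecidableEq ι] in
lemma ind_le_ind {P Q : (ι → Bool) → Prop} {x y : ι → Bool} (h : P x → Q y) :
    ind P x ≤ ind Q y := by
  by_cases hx : P x
  · simp [ind, hx, h hx]
  · simpa [ind, hx] using ind_nonneg Q y

/-- One step of the comparison with product measures: if all the conditional probabilities are on
the correct side of `q` with high probability, then all the local fields are on the correct side
of `Ψ q`, up to `ε`, with high probability. -/
lemma Regular.mean_ind_localField_le (H : Regular c T Ψ dΨ K r) (hK : 0 < K) (hr : 0 < r)
    (h : ι → ℝ) {q σ ε : ℝ} (hq : q ∈ Set.Icc (0 : ℝ) 1) (hσ : σ = 1 ∨ σ = -1) (hε : 0 < ε)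
    (hrε : K / r ≤ ε / 2) :
    mean (gibbs (energyField c T h))
        (ind fun x => ∃ a, ε < σ * (localField c T a x - Ψ q))
      ≤ r ^ 2 * mean (gibbs (energyField c T h))
          (ind fun x => ∃ a, 0 < σ * (rate (energyField c T h) a x - q))
        + r ^ 2 * Real.exp (-(ε ^ 2 / (16 * K ^ 3)) * r) := by
  set U := energyField c T h
  set f := ind fun x => ∃ a, ε < σ * (localField c T a x - Ψ q) with hf
  have hσ2 : σ ^ 2 = 1 := by rcases hσ with h | h <;> rw [h] <;> norm_num
  have hmono : ∀ a x, 0 ≤ σ * ddiff a f x := by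
    intro a x
    have hd : ∀ b, localField c T b (Function.update x a false)
        ≤ localField c T b (Function.update x a true) :=
      fun b => sub_nonneg.1 (ddiff_localField_nonneg H.coeff_nonneg b a x)
    rcases hσ with rfl | rfl
    · rw [one_mul, ddiff, sub_nonneg]
      refine ind_le_ind ?_
      rintro ⟨b, hb⟩
      exact ⟨b, by linarith [hd b]⟩
    · rw [neg_one_mul, ddiff, neg_sub, sub_nonneg]
      refine ind_le_ind ?_
      rintro ⟨b, hb⟩
      exact ⟨b, by linarith [hd b]⟩
  have hcomp := mean_le_mean_resampleList U hq.1 hq.2 hσ2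
    (bad := ind fun x => ∃ a, 0 < σ * (rate U a x - q)) (ind_nonneg _)
    (fun a x => by
      by_cases hx : ∃ a, 0 < σ * (rate U a x - q)
      · right; simp [ind, hx]
      · left; push Not at hx; exact hx a)
    (ind_nonneg _) (ind_le_one _) hmono Finset.univ.toList
  refine hcomp.trans ?_
  rw [add_comm, Finset.length_toList, Finset.card_univ]
  have hw : ∀ x, 0 ≤ gibbs U x := fun x => (gibbs_pos U x).le
  have hbad0 : 0 ≤ mean (gibbs U) (ind fun x => ∃ a, 0 < σ * (rate U a x - q)) :=
    Finset.sum_nonneg fun x _ => mul_nonneg (hw x) (ind_nonneg _ x)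
  refine add_le_add (mul_le_mul_of_nonneg_right H.card_index_le hbad0) ?_
  rw [← mean_const (gibbs_sum U) (r ^ 2 * Real.exp (-(ε ^ 2 / (16 * K ^ 3)) * r))]
  refine mean_mono hw fun x => ?_
  set θ := ε * r / (4 * K ^ 3) with hθ
  have hθ0 : 0 < θ := by positivity
  have hle : ∀ x, f x ≤ ∑ a, 1 * Real.exp ((θ * σ) * localField c T a x
      + (-(θ * σ * Ψ q) - θ * ε)) := by
    intro x
    by_cases hx : ∃ a, ε < σ * (localField c T a x - Ψ q)
    · obtain ⟨a, ha⟩ := hx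
      refine (ind_le_one _ x).trans ?_
      refine le_trans ?_ (Finset.single_le_sum (fun b _ => ?_) (Finset.mem_univ a))
      · rw [one_mul]
        refine Real.one_le_exp ?_
        have := mul_pos hθ0 (sub_pos.2 ha)
        nlinarith
      · exact mul_nonneg zero_le_one (Real.exp_pos _).le
    · rw [hf, ind, if_neg hx]
      exact Finset.sum_nonneg fun b _ => by positivity
  refine (resampleList_mono hq.1 hq.2 _ hle x).trans ?_
  rw [resampleList_sum]
  refine (Finset.sum_le_card_nsmul _ _ (Real.exp (-(ε ^ 2 / (16 * K ^ 3)) * r)) ?_).trans ?_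
  · intro a _
    rw [one_mul]
    set d : ι → ℝ := fun b => if b = a then 0 else θ * infl c T a b with hd
    refine (resampleList_exp_le hq.1 hq.2 _ (d := d) ?_ x).trans (Real.exp_le_exp.2 ?_)
    · intro b y
      have e : ddiff b (fun x => θ * σ * localField c T a x + (-(θ * σ * Ψ q) - θ * ε)) y
          = θ * σ * ddiff b (localField c T a) y := by
        simp only [ddiff]; ring
      have habs : |σ| = 1 := by rcases hσ with h | h <;> rw [h] <;> simp
      rw [e, abs_mul, abs_mul, habs, mul_one, abs_of_pos hθ0,
        abs_of_nonneg (ddiff_localField_nonneg H.coeff_nonneg a b y)]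
      by_cases hb : b = a
      · simp [hd, hb, ddiff_localField_self]
      · simp only [hd, hb, if_false]
        exact mul_le_mul_of_nonneg_left (ddiff_localField_le H.coeff_nonneg y) hθ0.le
    · rw [resampleList_affine, resampleList_localField]
      have h1 := H.profile_le a q hq
      have h2 := H.le_profile a q hq
      set Q := ∑ j with a ∈ T j, c j * q ^ ((T j).card - 1)
      have h3 : θ * σ * Q + (-(θ * σ * Ψ q) - θ * ε) ≤ -(θ * ε / 2) := by
        have : σ * (Q - Ψ q) ≤ ε / 2 := by
          have : 0 ≤ K / r := by positivity
          rcases hσ with rfl | rfl <;> linarith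
        nlinarith [mul_le_mul_of_nonneg_left this hθ0.le]
      have h4 : ((Finset.univ.toList).map fun b => d b ^ 2).sum ≤ θ ^ 2 * (K / r * K ^ 2) := by
        rw [Finset.sum_map_toList]
        calc ∑ b, d b ^ 2 ≤ ∑ b, θ ^ 2 * (K / r * infl c T a b) := by
              refine Finset.sum_le_sum fun b _ => ?_
              have h0 := infl_nonneg (T := T) H.coeff_nonneg a b
              by_cases hb : b = a
              · have h00 : 0 ≤ θ ^ 2 * (K / r * infl c T a b) := by positivity
                simpa [hd, hb] using h00
              · simp only [hd, hb, if_false, mul_pow]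
                refine mul_le_mul_of_nonneg_left ?_ (sq_nonneg θ)
                rw [sq]
                exact mul_le_mul_of_nonneg_right (H.infl_le a b (Ne.symm hb)) h0
          _ = θ ^ 2 * (K / r * ∑ b, infl c T a b) := by simp only [Finset.mul_sum]
          _ ≤ θ ^ 2 * (K / r * K ^ 2) := by
              have := H.sum_infl_le a
              gcongr
      have h5 : -(θ * ε / 2) + θ ^ 2 * (K / r * K ^ 2) = -(ε ^ 2 / (16 * K ^ 3)) * r := by
        rw [hθ]; field_simp; ring
      linarith
  · rw [nsmul_eq_mul, Finset.card_univ]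
    exact mul_le_mul_of_nonneg_right H.card_index_le (Real.exp_pos _).le

end Polynomial

section Confinement

/-- For large `r`, in every regular system with a small external field, with high probability all
the conditional probabilities are on the `σ` side of `q`: at most `q` if `σ = 1` and at least `q`
if `σ = -1`. -/
def Confined (Ψ dΨ : ℝ → ℝ) (K σ q : ℝ) : Prop :=
  ∃ δ > 0, ∃ κ > 0, ∃ N : ℝ, ∀ r ≥ N, ∀ (ι J : Type) [Fintype ι] [DecidableEq ι] [Fintype J]
    (c : J → ℝ) (T : J → Finset ι), Regular c T Ψ dΨ K r → ∀ h : ι → ℝ, (∀ a, |h a| ≤ δ) →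
      mean (gibbs (energyField c T h))
        (ind fun x => ∃ a, 0 < σ * (rate (energyField c T h) a x - q)) ≤ Real.exp (-κ * r)

variable {Ψ dΨ : ℝ → ℝ} {K σ q : ℝ}

lemma two_mul_sq_le_exp {κ r : ℝ} (hκ : 0 < κ) (hr : 12 / κ ^ 3 ≤ r) :
    2 * r ^ 2 ≤ Real.exp (κ * r) := by
  have hr0 : 0 < r := lt_of_lt_of_le (by positivity) hr
  refine le_trans ?_ (Real.pow_div_factorial_le_exp (κ * r) (by positivity) 3)
  rw [div_le_iff₀ (by positivity)] at hr
  have h6 : ((Nat.factorial 3 : ℕ) : ℝ) = 6 := by norm_num [Nat.factorial]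
  rw [h6, le_div_iff₀ (by norm_num)]
  nlinarith [sq_nonneg r]

lemma Confined.of_forall (hq : ∀ t, 0 < t → t < 1 → σ * (t - q) ≤ 0) : Confined Ψ dΨ K σ q := by
  refine ⟨1, one_pos, 1, one_pos, 0, fun r _ ι J _ _ _ c T _ h _ => ?_⟩
  have : (ind fun x => ∃ a, 0 < σ * (rate (energyField c T h) a x - q)) = fun _ => 0 := by
    funext x
    rw [ind, if_neg]
    rintro ⟨a, ha⟩
    exact absurd (hq _ (Phi_pos _) (Phi_lt_one _)) (not_le.2 ha)
  rw [this, mean_const (gibbs_sum _)]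
  positivity

lemma Confined.step (hK : 0 < K) (hσ : σ = 1 ∨ σ = -1) (hq : q ∈ Set.Icc (0 : ℝ) 1)
    (hC : Confined Ψ dΨ K σ q) {ε q' : ℝ} (hε : 0 < ε)
    (hq' : σ * (Phi (Ψ q + 2 * σ * ε) - q') ≤ 0) : Confined Ψ dΨ K σ q' := by
  obtain ⟨δ, hδ, κ, hκ, N, hN⟩ := hC
  set κ₁ := ε ^ 2 / (16 * K ^ 3) with hκ₁
  have hκ₁0 : 0 < κ₁ := by positivity
  set κ' := min κ κ₁ / 2 with hκ'
  have hκ'0 : 0 < κ' := half_pos (lt_min hκ hκ₁0)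
  refine ⟨min δ ε, lt_min hδ hε, κ', hκ'0, max N (max 1 (max (2 * K / ε) (12 / κ' ^ 3))), ?_⟩
  intro r hr ι J _ _ _ c T H h hh
  simp only [ge_iff_le, max_le_iff] at hr
  obtain ⟨hrN, hr1, hr2, hr3⟩ := hr
  have hr0 : 0 < r := by linarith
  have hrε : K / r ≤ ε / 2 := by
    rw [div_le_iff₀ hε] at hr2
    rw [div_le_iff₀ hr0]
    linarith
  have h1 := hN r hrN ι J c T H h fun a => (hh a).trans (min_le_left _ _)
  have h2 := H.mean_ind_localField_le hK hr0 h hq hσ hε hrε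
  have h3 : mean (gibbs (energyField c T h))
        (ind fun x => ∃ a, 0 < σ * (rate (energyField c T h) a x - q'))
      ≤ mean (gibbs (energyField c T h)) (ind fun x => ∃ a, ε < σ * (localField c T a x - Ψ q)) := by
    refine mean_mono (fun x => (gibbs_pos _ x).le) fun x => ind_le_ind ?_
    rintro ⟨a, ha⟩
    refine ⟨a, ?_⟩
    by_contra hcon
    push Not at hcon
    refine absurd ha (not_lt.2 ?_)
    have hha := abs_le.1 ((hh a).trans (min_le_right _ _))
    rw [rate_energyField]
    rcases hσ with rfl | rfl
    · have := Phi_strictMono.monotone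
        (show localField c T a x + h a ≤ Ψ q + 2 * 1 * ε by linarith [hha.2])
      linarith
    · have := Phi_strictMono.monotone
        (show Ψ q + 2 * -1 * ε ≤ localField c T a x + h a by linarith [hha.1])
      linarith
  refine h3.trans (h2.trans ?_)
  have h4 := two_mul_sq_le_exp hκ'0 hr3
  have e1 : Real.exp (-κ * r) ≤ Real.exp (-(2 * κ') * r) :=
    Real.exp_le_exp.2 (by
      have : 2 * κ' ≤ κ := by rw [hκ']; linarith [min_le_left κ κ₁]
      nlinarith)
  have e2 : Real.exp (-κ₁ * r) ≤ Real.exp (-(2 * κ') * r) :=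
    Real.exp_le_exp.2 (by
      have : 2 * κ' ≤ κ₁ := by rw [hκ']; linarith [min_le_right κ κ₁]
      nlinarith)
  calc _ ≤ r ^ 2 * Real.exp (-(2 * κ') * r) + r ^ 2 * Real.exp (-(2 * κ') * r) := by
        gcongr
        exact h1.trans e1
    _ = 2 * r ^ 2 * Real.exp (-(2 * κ') * r) := by ring
    _ ≤ Real.exp (κ' * r) * Real.exp (-(2 * κ') * r) := by gcongr
    _ = Real.exp (-κ' * r) := by rw [← Real.exp_add]; ring_nf

/-- The mean-field description of sub-criticality, with `dΨ` in the role of the derivative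
of `Ψ`. -/
structure MeanFieldSubcritical (Ψ dΨ : ℝ → ℝ) (p : ℝ) : Prop where
  continuous_profile : Continuous Ψ
  continuous_slope : Continuous dΨ
  slope_nonneg : ∀ q ∈ Set.Icc (0 : ℝ) 1, 0 ≤ dΨ q
  fixed : Phi (Ψ p) = p
  unique : ∀ q, Phi (Ψ q) = q → q = p
  slope_lt : p * (1 - p) * dΨ p < 1

lemma MeanFieldSubcritical.drift_pos {p : ℝ} (M : MeanFieldSubcritical Ψ dΨ p)
    (hσ : σ = 1 ∨ σ = -1) (hq : q ∈ Set.Icc (0 : ℝ) 1) (h : 0 < σ * (q - p)) :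
    0 < σ * (q - Phi (Ψ q)) := by
  have hc : Continuous fun q => q - Phi (Ψ q) :=
    continuous_id.sub (continuous_Phi.comp M.continuous_profile)
  by_contra hcon
  push Not at hcon
  rcases hσ with rfl | rfl
  · obtain ⟨t, ht, h0⟩ := intermediate_value_Icc hq.2 hc.continuousOn
      (show (0 : ℝ) ∈ Set.Icc (q - Phi (Ψ q)) (1 - Phi (Ψ 1)) from
        ⟨by linarith, by linarith [Phi_lt_one (Ψ 1)]⟩)
    have := M.unique t (by simp only at h0; linarith)
    linarith [ht.1]
  · obtain ⟨t, ht, h0⟩ := intermediate_value_Icc hq.1 hc.continuousOn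
      (show (0 : ℝ) ∈ Set.Icc (0 - Phi (Ψ 0)) (q - Phi (Ψ q)) from
        ⟨by linarith [Phi_pos (Ψ 0)], by linarith⟩)
    have := M.unique t (by simp only at h0; linarith)
    linarith [ht.2]

/-- In the sub-critical regime, all the conditional probabilities are close to `p` with high
probability. -/
lemma MeanFieldSubcritical.confined {p : ℝ} (M : MeanFieldSubcritical Ψ dΨ p) (hK : 0 < K)
    (hσ : σ = 1 ∨ σ = -1) {η : ℝ} (hη : 0 < η) : Confined Ψ dΨ K σ (p + σ * η) := by
  have hσ2 : σ * σ = 1 := by rcases hσ with h | h <;> rw [h] <;> norm_num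
  set S := Set.Icc (0 : ℝ) 1 ∩ {q | η ≤ σ * (q - p)} with hS
  have hScomp : IsCompact S := isCompact_Icc.inter_right
    (isClosed_le continuous_const (continuous_const.mul (continuous_id.sub continuous_const)))
  have hgcont : Continuous fun q => σ * (q - Phi (Ψ q)) :=
    continuous_const.mul (continuous_id.sub (continuous_Phi.comp M.continuous_profile))
  obtain ⟨κ, hκ, hgap⟩ : ∃ κ > 0, ∀ q ∈ S, 2 * κ ≤ σ * (q - Phi (Ψ q)) := by
    rcases S.eq_empty_or_nonempty with hemp | hne
    · exact ⟨1, one_pos, fun q hq => by rw [hemp] at hq; exact hq.elim⟩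
    · obtain ⟨q₀, hq₀, hmin⟩ := hScomp.exists_isMinOn hne hgcont.continuousOn
      have := M.drift_pos hσ hq₀.1 (hη.trans_le hq₀.2)
      exact ⟨_, half_pos this, fun q hq => by
        have := isMinOn_iff.1 hmin q hq
        linarith⟩
  have hp := M.fixed ▸ Phi_pos (Ψ p)
  have hp1 := M.fixed ▸ Phi_lt_one (Ψ p)
  have reach : ∀ k : ℕ, ∃ q ∈ Set.Icc (0 : ℝ) 1, Confined Ψ dΨ K σ q ∧
      (σ * (q - p) ≤ η ∨ k * κ ≤ σ * ((1 + σ) / 2 - q)) := by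
    intro k
    induction k with
    | zero =>
      refine ⟨(1 + σ) / 2, ?_, Confined.of_forall ?_, Or.inr (by simp)⟩
      · rcases hσ with rfl | rfl <;> norm_num
      · intro t h0 h1
        rcases hσ with rfl | rfl <;> linarith
    | succ k ih =>
      obtain ⟨q, hq, hC, hk⟩ := ih
      by_cases hnear : σ * (q - p) ≤ η
      · exact ⟨q, hq, hC, Or.inl hnear⟩
      · have hg := hgap q ⟨hq, (not_le.1 hnear).le⟩
        have h0 := Phi_pos (Ψ q)
        have h1 := Phi_lt_one (Ψ q)
        refine ⟨q - σ * κ, ?_, hC.step hK hσ hq (half_pos hκ) ?_, Or.inr ?_⟩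
        · rcases hσ with rfl | rfl <;> constructor <;> linarith [hq.1, hq.2]
        · have hlip := abs_le.1 (abs_Phi_sub_le_abs (Ψ q + 2 * σ * (κ / 2)) (Ψ q))
          rcases hσ with rfl | rfl
          · have : |Ψ q + 2 * 1 * (κ / 2) - Ψ q| = κ := by
              rw [show Ψ q + 2 * 1 * (κ / 2) - Ψ q = κ by ring, abs_of_pos hκ]
            linarith [hlip.2]
          · have : |Ψ q + 2 * -1 * (κ / 2) - Ψ q| = κ := by
              rw [show Ψ q + 2 * -1 * (κ / 2) - Ψ q = -κ by ring, abs_neg, abs_of_pos hκ]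
            linarith [hlip.1]
        · have := hk.resolve_left hnear
          push_cast
          nlinarith
  obtain ⟨k, hk⟩ := exists_nat_gt (1 / κ)
  rw [div_lt_iff₀ hκ] at hk
  obtain ⟨q, hq, hC, hor⟩ := reach k
  have hfin : σ * (q - p) ≤ η := by
    rcases hor with h | h
    · exact h
    · exfalso
      rcases hσ with rfl | rfl <;> linarith [hq.1, hq.2]
  obtain ⟨δ, hδ, κ', hκ', N, hN⟩ := hC
  refine ⟨δ, hδ, κ', hκ', N, fun r hr ι J _ _ _ c T H h hh => ?_⟩
  refine le_trans ?_ (hN r hr ι J c T H h hh)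
  refine mean_mono (fun x => (gibbs_pos _ x).le) fun x => ind_le_ind ?_
  rintro ⟨a, ha⟩
  exact ⟨a, by nlinarith⟩

end Confinement

section Decoupling

variable {ι J : Type*} [Fintype ι] [DecidableEq ι]

lemma abs_mean_spin_sub_rate_mul_le (U : (ι → Bool) → ℝ) (a : ι) {g : (ι → Bool) → ℝ} {L : ℝ}
    (hg : ∀ x, |ddiff a g x| ≤ L) :
    |mean (gibbs U) fun x => (spin (x a) - rate U a x) * g x| ≤ L := by
  rw [← mean_resample_rate U a]
  refine abs_mean_le (fun x => (gibbs_pos U x).le) (gibbs_sum U) fun x => ?_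
  have h0 : 0 ≤ rate U a x := (Phi_pos _).le
  have h1 : rate U a x ≤ 1 := (Phi_lt_one _).le
  have hr : ∀ b, rate U a (Function.update x a b) = rate U a x := fun b => by
    rw [rate, rate, ddiff_update]
  have e : resample (rate U a x) a (fun x => (spin (x a) - rate U a x) * g x) x
      = rate U a x * (1 - rate U a x) * ddiff a g x := by
    simp only [resample, ddiff, hr, Function.update_self, spin_true, spin_false]
    ring
  rw [e, abs_mul, abs_of_nonneg (mul_nonneg h0 (sub_nonneg.2 h1))]
  refine (mul_le_of_le_one_left (abs_nonneg _) ?_).trans (hg x)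
  nlinarith

/-- The product of the conditional probabilities at the coordinates in `S`. -/
noncomputable def rateProd (U : (ι → Bool) → ℝ) (S : Finset ι) (x : ι → Bool) : ℝ :=
  ∏ b ∈ S, rate U b x

/-- The difference between a monomial and the product of conditional probabilities. -/
noncomputable def deviation (U : (ι → Bool) → ℝ) (S : Finset ι) (x : ι → Bool) : ℝ :=
  monom S x - rateProd U S x

variable {U : (ι → Bool) → ℝ}

omit [Fintype ι] in
lemma rate_nonneg (a : ι) (x : ι → Bool) : 0 ≤ rate U a x := (Phi_pos _).le

omit [Fintype ι] in
lemma rate_le_one (a : ι) (x : ι → Bool) : rate U a x ≤ 1 := (Phi_lt_one _).le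

omit [Fintype ι] in
lemma abs_rate_le_one (a : ι) (x : ι → Bool) : |rate U a x| ≤ 1 := by
  rw [abs_of_nonneg (rate_nonneg a x)]
  exact rate_le_one a x

omit [Fintype ι] in
lemma rateProd_nonneg (S : Finset ι) (x : ι → Bool) : 0 ≤ rateProd U S x :=
  Finset.prod_nonneg fun _ _ => (Phi_pos _).le

omit [Fintype ι] in
lemma rateProd_le_one (S : Finset ι) (x : ι → Bool) : rateProd U S x ≤ 1 :=
  Finset.prod_le_one (fun _ _ => (Phi_pos _).le) fun _ _ => (Phi_lt_one _).le

omit [Fintype ι] in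
lemma abs_deviation_le_one (S : Finset ι) (x : ι → Bool) : |deviation U S x| ≤ 1 := by
  have h1 := rateProd_nonneg (U := U) S x
  have h2 := rateProd_le_one (U := U) S x
  have h3 := monom_nonneg S x
  have h4 := monom_le_one S x
  rw [deviation, abs_le]
  constructor <;> linarith

omit [Fintype ι] in
lemma abs_ddiff_mul_le {a : ι} {f g : (ι → Bool) → ℝ} {L M : ℝ} (hf : ∀ x, |f x| ≤ 1)
    (hg : ∀ x, |g x| ≤ 1) (hL : ∀ x, |ddiff a f x| ≤ L) (hM : ∀ x, |ddiff a g x| ≤ M)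
    (x : ι → Bool) : |ddiff a (fun x => f x * g x) x| ≤ L + M := by
  have e : ddiff a (fun x => f x * g x) x
      = ddiff a f x * g (Function.update x a true)
        + f (Function.update x a false) * ddiff a g x := by
    simp only [ddiff]; ring
  rw [e]
  refine (abs_add_le _ _).trans (add_le_add ?_ ?_)
  · rw [abs_mul]
    exact (mul_le_of_le_one_right (abs_nonneg _) (hg _)).trans (hL x)
  · rw [abs_mul]
    exact (mul_le_of_le_one_left (abs_nonneg _) (hf _)).trans (hM x)

omit [Fintype ι] in
lemma abs_ddiff_rateProd_le {ℓ : ℝ} (hℓ : ∀ a b x, |ddiff b (rate U a) x| ≤ ℓ) (S : Finset ι)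
    (b : ι) (x : ι → Bool) : |ddiff b (rateProd U S) x| ≤ S.card * ℓ := by
  induction S using Finset.induction_on generalizing x with
  | empty => simp [ddiff, rateProd]
  | insert a S ha ih =>
    have e : rateProd U (insert a S) = fun x => rate U a x * rateProd U S x := by
      funext x; rw [rateProd, Finset.prod_insert ha]; rfl
    rw [e, Finset.card_insert_of_notMem ha]
    refine (abs_ddiff_mul_le (abs_rate_le_one a) (fun x => ?_) (hℓ a b) ih x).trans
      (le_of_eq ?_)
    · rw [abs_of_nonneg (rateProd_nonneg _ _)]; exact rateProd_le_one _ _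
    · push_cast; ring

lemma abs_mean_deviation_mul_le {ℓ : ℝ} (hℓ : ∀ a b x, |ddiff b (rate U a) x| ≤ ℓ)
    (S : Finset ι) {g : (ι → Bool) → ℝ} {L : ℝ} (hg : ∀ x, |g x| ≤ 1)
    (hL : ∀ b ∈ S, ∀ x, |ddiff b g x| ≤ L) :
    |mean (gibbs U) fun x => deviation U S x * g x| ≤ S.card * L + S.card ^ 2 * ℓ := by
  induction S using Finset.induction_on generalizing g L with
  | empty => simp [deviation, rateProd, monom, mean]
  | insert a S ha ih =>
    have e : (fun x => deviation U (insert a S) x * g x) = fun x =>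
        (spin (x a) - rate U a x) * (monom S x * g x)
          + deviation U S x * (rate U a x * g x) := by
      funext x
      simp only [deviation, rateProd, monom, Finset.prod_insert ha]
      ring
    have hmon : ∀ x, |monom S x| ≤ 1 := fun x => by
      rw [abs_of_nonneg (monom_nonneg _ _)]; exact monom_le_one _ _
    have hℓ0 : 0 ≤ ℓ := (abs_nonneg _).trans (hℓ a a fun _ => true)
    rw [e, mean_add]
    have h1 := abs_mean_spin_sub_rate_mul_le U a (g := fun x => monom S x * g x) (L := 0 + L)
      (abs_ddiff_mul_le hmon hg (fun x => by rw [ddiff_monom, if_neg ha, abs_zero])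
        (hL a (Finset.mem_insert_self _ _)))
    have h2 := ih (g := fun x => rate U a x * g x) (L := ℓ + L)
      (fun x => by
        rw [abs_mul]
        exact mul_le_one₀ (abs_rate_le_one a x) (abs_nonneg _) (hg x))
      (fun b hb => abs_ddiff_mul_le (abs_rate_le_one a) hg (hℓ a b) (hL b (Finset.mem_insert_of_mem hb)))
    refine (abs_add_le _ _).trans ((add_le_add h1 h2).trans ?_)
    rw [Finset.card_insert_of_notMem ha]
    push_cast
    nlinarith [mul_nonneg (Nat.cast_nonneg (α := ℝ) S.card) hℓ0]

lemma abs_mean_deviation_mul_deviation_le {ℓ : ℝ} (hℓ : ∀ a b x, |ddiff b (rate U a) x| ≤ ℓ)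
    (hℓ0 : 0 ≤ ℓ) {S T : Finset ι} (hST : Disjoint S T) {k : ℝ} (hS : (S.card : ℝ) ≤ k)
    (hT : (T.card : ℝ) ≤ k) :
    |mean (gibbs U) fun x => deviation U S x * deviation U T x| ≤ 2 * k ^ 2 * ℓ := by
  have h := abs_mean_deviation_mul_le hℓ S (g := deviation U T) (L := k * ℓ)
    (abs_deviation_le_one T) (fun b hb x => by
      have hbT : b ∉ T := Finset.disjoint_left.1 hST hb
      have e : ddiff b (deviation U T) x = -ddiff b (rateProd U T) x := by
        simp only [ddiff, deviation, monom_update_of_notMem hbT]; ring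
      rw [e, abs_neg]
      exact (abs_ddiff_rateProd_le hℓ T b x).trans (mul_le_mul_of_nonneg_right hT hℓ0))
  refine h.trans ?_
  have hc : (0 : ℝ) ≤ S.card := Nat.cast_nonneg _
  have h1 : (S.card : ℝ) * (k * ℓ) ≤ k * (k * ℓ) :=
    mul_le_mul_of_nonneg_right hS (mul_nonneg (hc.trans hS) hℓ0)
  have h2 : (S.card : ℝ) ^ 2 * ℓ ≤ k ^ 2 * ℓ := by gcongr
  nlinarith

end Decoupling

section Discrepancy

variable {ι : Type*} [Fintype ι] [DecidableEq ι]

/-- The mean square difference of `f` between two independent samples from `w`. -/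
def disc (w f : (ι → Bool) → ℝ) : ℝ := mean w fun x => mean w fun y => (f x - f y) ^ 2

variable {w : (ι → Bool) → ℝ}

lemma disc_nonneg (hw : ∀ x, 0 ≤ w x) (f : (ι → Bool) → ℝ) : 0 ≤ disc w f :=
  Finset.sum_nonneg fun x _ => mul_nonneg (hw x) <|
    Finset.sum_nonneg fun y _ => mul_nonneg (hw y) (sq_nonneg _)

lemma disc_le_sum {B : Type*} (hw : ∀ x, 0 ≤ w x) (hw1 : ∑ x, w x = 1) (s : Finset B)
    {f bad : (ι → Bool) → ℝ} {g : B → (ι → Bool) → ℝ} {α : B → ℝ} {m : ℝ}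
    (h : ∀ x y, (f x - f y) ^ 2 ≤ ∑ b ∈ s, α b * (g b x - g b y) ^ 2 + m * (bad x + bad y)) :
    disc w f ≤ ∑ b ∈ s, α b * disc w (g b) + 2 * m * mean w bad := by
  refine (mean_mono hw fun x => mean_mono hw (h x)).trans (le_of_eq ?_)
  simp only [mean_add, mean_sum, mean_const_mul, mean_const hw1, disc]
  ring

lemma disc_add_le (hw : ∀ x, 0 ≤ w x) (hw1 : ∑ x, w x = 1) {τ : ℝ} (hτ : 0 < τ)
    (f g : (ι → Bool) → ℝ) :
    disc w (fun x => f x + g x) ≤ (1 + τ) * disc w f + (1 + 1 / τ) * disc w g := by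
  have h := disc_le_sum (B := Bool) hw hw1 Finset.univ (f := fun x => f x + g x)
    (bad := fun _ => 0) (g := fun b => if b then f else g)
    (α := fun b => if b then 1 + τ else 1 + 1 / τ) (m := 0) fun x y => by
      simp only [Fintype.sum_bool, if_true, Bool.false_eq_true, if_false, zero_mul, add_zero]
      have e : (1 + τ) * (f x - f y) ^ 2 + (1 + 1 / τ) * (g x - g y) ^ 2
          - (f x + g x - (f y + g y)) ^ 2 = (τ * (f x - f y) - (g x - g y)) ^ 2 / τ := by
        field_simp; ring
      have : 0 ≤ (τ * (f x - f y) - (g x - g y)) ^ 2 / τ := by positivity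
      linarith
  simpa using h

lemma disc_eq (hw1 : ∑ x, w x = 1) (f : (ι → Bool) → ℝ) :
    disc w f = 2 * (mean w (fun x => f x ^ 2) - mean w f ^ 2) := by
  have : ∀ x y, (f x - f y) ^ 2 = f x ^ 2 + ((-2 * f x) * f y + f y ^ 2) := fun x y => by ring
  simp only [disc, this, mean_add, mean_const_mul, mean_const hw1]
  have h2 : (fun x => -2 * f x * mean w f) = fun x => (-2 * mean w f) * f x := by
    funext x; ring
  rw [h2, mean_const_mul]
  ring

lemma disc_le_two_mul (hw1 : ∑ x, w x = 1) (f : (ι → Bool) → ℝ) :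
    disc w f ≤ 2 * mean w fun x => f x ^ 2 := by
  rw [disc_eq hw1]
  nlinarith [sq_nonneg (mean w f)]

end Discrepancy

lemma sq_sum_mul_le {B : Type*} (s : Finset B) {α δ : B → ℝ} (hα : ∀ b ∈ s, 0 ≤ α b) {A : ℝ}
    (hA : ∑ b ∈ s, α b ≤ A) : (∑ b ∈ s, α b * δ b) ^ 2 ≤ A * ∑ b ∈ s, α b * δ b ^ 2 := by
  have h0 : ∀ b ∈ s, 0 ≤ α b * δ b ^ 2 := fun b hb => mul_nonneg (hα b hb) (sq_nonneg _)
  exact (Finset.sum_sq_le_sum_mul_sum_of_sq_le_mul s hα h0 fun b _ => (by ring : _ = _).le).trans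
    (mul_le_mul_of_nonneg_right hA (Finset.sum_nonneg h0))

lemma abs_prod_sub_prod_le {ι : Type*} [DecidableEq ι] {q : ℝ} (S : Finset ι) {f g : ι → ℝ}
    (hf : ∀ b, f b ∈ Set.Icc 0 q) (hg : ∀ b, g b ∈ Set.Icc 0 q) :
    |∏ b ∈ S, f b - ∏ b ∈ S, g b| ≤ q ^ (S.card - 1) * ∑ b ∈ S, |f b - g b| := by
  have hprod : ∀ S : Finset ι, |∏ b ∈ S, f b| ≤ q ^ S.card := fun S => by
    rw [Finset.abs_prod, ← Finset.prod_const]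
    refine Finset.prod_le_prod (fun _ _ => abs_nonneg _) fun b _ => ?_
    rw [abs_of_nonneg (hf b).1]; exact (hf b).2
  induction S using Finset.induction_on with
  | empty => simp
  | insert a S ha ih =>
    have hq : 0 ≤ q := (hf a).1.trans (hf a).2
    rw [Finset.prod_insert ha, Finset.prod_insert ha, Finset.sum_insert ha,
      Finset.card_insert_of_notMem ha, Nat.add_sub_cancel]
    have e : f a * ∏ b ∈ S, f b - g a * ∏ b ∈ S, g b
        = (f a - g a) * ∏ b ∈ S, f b + g a * (∏ b ∈ S, f b - ∏ b ∈ S, g b) := by ring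
    rw [e, mul_add]
    refine (abs_add_le _ _).trans (add_le_add ?_ ?_)
    · rw [abs_mul, mul_comm]
      exact mul_le_mul_of_nonneg_right (hprod S) (abs_nonneg _)
    · rw [abs_mul, abs_of_nonneg (hg a).1]
      rcases S.eq_empty_or_nonempty with rfl | hS
      · simp
      · refine (mul_le_mul (hg a).2 ih (abs_nonneg _) hq).trans (le_of_eq ?_)
        rw [← mul_assoc, ← pow_succ', Nat.sub_add_cancel hS.card_pos]

section Contraction

variable {ι J : Type*} [Fintype ι] [DecidableEq ι] [Fintype J] {c : J → ℝ} {T : J → Finset ι}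
  {Ψ dΨ : ℝ → ℝ} {K r : ℝ}

lemma Regular.abs_ddiff_rate_le (H : Regular c T Ψ dΨ K r) (hK : 0 < K) (hr : 0 < r) (h : ι → ℝ)
    (a b : ι) (x : ι → Bool) : |ddiff b (rate (energyField c T h) a) x| ≤ K / r := by
  have h1 : |ddiff b (rate (energyField c T h) a) x| ≤ |ddiff b (localField c T a) x| := by
    simp only [ddiff, rate_energyField]
    refine (abs_Phi_sub_le_abs _ _).trans (le_of_eq ?_)
    congr 1; ring
  refine h1.trans ?_
  rw [abs_of_nonneg (ddiff_localField_nonneg H.coeff_nonneg a b x)]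
  by_cases hab : a = b
  · rw [← hab, ddiff_localField_self]; positivity
  · exact (ddiff_localField_le H.coeff_nonneg x).trans (H.infl_le a b hab)

/-- The local field at `a` with all the spins replaced by their conditional probabilities. -/
noncomputable def fieldProd (c : J → ℝ) (T : J → Finset ι) (U : (ι → Bool) → ℝ) (a : ι)
    (x : ι → Bool) : ℝ := ∑ j with a ∈ T j, c j * rateProd U ((T j).erase a) x

lemma Regular.mean_sq_localField_sub_fieldProd_le (H : Regular c T Ψ dΨ K r) (hK : 0 < K)
    (hr : 0 < r) (h : ι → ℝ) (a : ι) :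
    mean (gibbs (energyField c T h))
        (fun x => (localField c T a x - fieldProd c T (energyField c T h) a x) ^ 2)
      ≤ (2 * K ^ 5 + K ^ 3) / r := by
  set U := energyField c T h
  set s : Finset J := {j | a ∈ T j} with hs
  set D : J → (ι → Bool) → ℝ := fun j => deviation U ((T j).erase a) with hD
  have hc := H.coeff_nonneg
  have hsum : ∑ j ∈ s, c j ≤ K := by simpa [infl, hs] using H.weight_le a
  have e : (fun x => (localField c T a x - fieldProd c T U a x) ^ 2)
      = fun x => ∑ j ∈ s, c j * ∑ k ∈ s, c k * (D j x * D k x) := by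
    funext x
    have : localField c T a x - fieldProd c T U a x = ∑ j ∈ s, c j * D j x := by
      simp only [localField, fieldProd, ← Finset.sum_sub_distrib, ← mul_sub, hD, deviation, hs]
    rw [this, sq, Finset.sum_mul_sum]
    refine Finset.sum_congr rfl fun j _ => ?_
    rw [Finset.mul_sum]
    exact Finset.sum_congr rfl fun k _ => by ring
  rw [e]
  simp only [mean_sum, mean_const_mul]
  have hpair : ∀ j k, mean (gibbs U) (fun x => D j x * D k x)
      ≤ 2 * K ^ 3 / r + ∑ b ∈ (T j).erase a, if b ∈ T k then 1 else 0 := by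
    intro j k
    have hcard : ∀ j, (((T j).erase a).card : ℝ) ≤ K := fun j =>
      (Nat.cast_le.2 (Finset.card_le_card (Finset.erase_subset a (T j)))).trans (H.card_le j)
    by_cases hd : Disjoint ((T j).erase a) ((T k).erase a)
    · have h1 := (abs_le.1 (abs_mean_deviation_mul_deviation_le (U := U) (ℓ := K / r)
        (H.abs_ddiff_rate_le hK hr h) (by positivity) hd (hcard j) (hcard k))).2
      have h2 : (0 : ℝ) ≤ ∑ b ∈ (T j).erase a, if b ∈ T k then 1 else 0 :=
        Finset.sum_nonneg fun b _ => by split_ifs <;> simp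
      have h3 : 2 * K ^ 2 * (K / r) = 2 * K ^ 3 / r := by ring
      linarith
    · obtain ⟨b, hb1, hb2⟩ := Finset.not_disjoint_iff.1 hd
      have h1 := (abs_le.1 (abs_mean_le (fun x => (gibbs_pos U x).le) (gibbs_sum U)
        (f := fun x => D j x * D k x) (L := 1) fun x => by
          rw [abs_mul]
          exact mul_le_one₀ (abs_deviation_le_one _ _) (abs_nonneg _)
            (abs_deviation_le_one _ _))).2
      have h2 : (1 : ℝ) ≤ ∑ b ∈ (T j).erase a, if b ∈ T k then 1 else 0 := by
        refine le_trans ?_ (Finset.single_le_sum (fun b _ => ?_) hb1)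
        · rw [if_pos (Finset.mem_of_mem_erase hb2)]
        · split_ifs <;> simp
      have h3 : 0 ≤ 2 * K ^ 3 / r := by positivity
      linarith
  have hrow : ∀ j, ∑ k ∈ s, c k * mean (gibbs U) (fun x => D j x * D k x)
      ≤ K * (2 * K ^ 3 / r) + K * (K / r) := by
    intro j
    calc ∑ k ∈ s, c k * mean (gibbs U) (fun x => D j x * D k x)
        ≤ ∑ k ∈ s, c k * (2 * K ^ 3 / r + ∑ b ∈ (T j).erase a, if b ∈ T k then 1 else 0) :=
          Finset.sum_le_sum fun k _ => mul_le_mul_of_nonneg_left (hpair j k) (hc k)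
      _ = (∑ k ∈ s, c k) * (2 * K ^ 3 / r) + ∑ b ∈ (T j).erase a, infl c T a b := by
          simp only [mul_add, Finset.sum_add_distrib, Finset.sum_mul]
          congr 1
          simp only [Finset.mul_sum]
          rw [Finset.sum_comm]
          refine Finset.sum_congr rfl fun b _ => ?_
          simp [infl, hs, Finset.sum_ite, ← Finset.filter_filter]
      _ ≤ _ := by
          refine add_le_add (mul_le_mul_of_nonneg_right hsum (by positivity)) ?_
          refine (Finset.sum_le_card_nsmul _ _ (K / r) fun b hb =>
            H.infl_le a b (Finset.ne_of_mem_erase hb).symm).trans ?_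
          rw [nsmul_eq_mul]
          refine mul_le_mul_of_nonneg_right (le_trans ?_ (H.card_le j)) (by positivity)
          exact Nat.cast_le.2 (Finset.card_le_card (Finset.erase_subset a (T j)))
  calc ∑ j ∈ s, c j * ∑ k ∈ s, c k * mean (gibbs U) (fun x => D j x * D k x)
      ≤ ∑ j ∈ s, c j * (K * (2 * K ^ 3 / r) + K * (K / r)) :=
        Finset.sum_le_sum fun j _ => mul_le_mul_of_nonneg_left (hrow j) (hc j)
    _ = (∑ j ∈ s, c j) * (K * (2 * K ^ 3 / r) + K * (K / r)) := by rw [Finset.sum_mul]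
    _ ≤ K * (K * (2 * K ^ 3 / r) + K * (K / r)) := by gcongr
    _ = _ := by ring

lemma Regular.fieldProd_mem (H : Regular c T Ψ dΨ K r) (U : (ι → Bool) → ℝ) (a : ι)
    (x : ι → Bool) : fieldProd c T U a x ∈ Set.Icc 0 K := by
  refine ⟨Finset.sum_nonneg fun j _ => mul_nonneg (H.coeff_nonneg j) (rateProd_nonneg _ _), ?_⟩
  refine le_trans ?_ (H.weight_le a)
  simp only [infl, and_self]
  exact Finset.sum_le_sum fun j _ =>
    mul_le_of_le_one_right (H.coeff_nonneg j) (rateProd_le_one _ _)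

lemma Regular.sq_fieldProd_sub_le (H : Regular c T Ψ dΨ K r) (U : (ι → Bool) → ℝ) {q : ℝ}
    (hq : q ∈ Set.Icc (0 : ℝ) 1) (a : ι) : ∃ α : ι → ℝ, (∀ b, 0 ≤ α b) ∧ ∑ b, α b ≤ dΨ q ∧
      ∀ x y, (∀ b, rate U b x ≤ q) → (∀ b, rate U b y ≤ q) →
        (fieldProd c T U a x - fieldProd c T U a y) ^ 2
          ≤ dΨ q * ∑ b, α b * (rate U b x - rate U b y) ^ 2 := by
  have hc := H.coeff_nonneg
  have hq0 := hq.1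
  set α : ι → ℝ := fun b => ∑ j with a ∈ T j,
    if b ∈ (T j).erase a then c j * q ^ ((T j).card - 1 - 1) else 0 with hα
  have hα0 : ∀ b, 0 ≤ α b := fun b => Finset.sum_nonneg fun j _ => by
    have := hc j
    split_ifs <;> positivity
  have hαf : ∀ f : ι → ℝ, ∑ b, α b * f b
      = ∑ j with a ∈ T j, c j * (q ^ ((T j).card - 1 - 1) * ∑ b ∈ (T j).erase a, f b) := by
    intro f
    simp only [hα, Finset.sum_mul]
    rw [Finset.sum_comm]
    refine Finset.sum_congr rfl fun j _ => ?_
    simp only [ite_mul, zero_mul, Finset.mul_sum, ← mul_assoc]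
    rw [Finset.sum_ite_mem, Finset.univ_inter]
  have hαsum : ∑ b, α b ≤ dΨ q := by
    have h1 := hαf fun _ => 1
    simp only [mul_one] at h1
    rw [h1]
    refine le_trans (le_of_eq (Finset.sum_congr rfl fun j hj => ?_)) (H.slope_le a q hq)
    rw [Finset.sum_const, Finset.card_erase_of_mem (Finset.mem_filter.1 hj).2, nsmul_eq_mul,
      mul_one, mul_comm (q ^ _)]
  refine ⟨α, hα0, hαsum, fun x y hx hy => ?_⟩
  have h1 : |fieldProd c T U a x - fieldProd c T U a y|
      ≤ ∑ b, α b * |rate U b x - rate U b y| := by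
    rw [hαf]
    simp only [fieldProd, ← Finset.sum_sub_distrib, ← mul_sub]
    refine (Finset.abs_sum_le_sum_abs _ _).trans (Finset.sum_le_sum fun j hj => ?_)
    rw [abs_mul, abs_of_nonneg (hc j)]
    refine mul_le_mul_of_nonneg_left ?_ (hc j)
    rw [← Finset.card_erase_of_mem (Finset.mem_filter.1 hj).2]
    exact abs_prod_sub_prod_le _ (fun b => ⟨rate_nonneg b x, hx b⟩)
      fun b => ⟨rate_nonneg b y, hy b⟩
  have h2 := sq_sum_mul_le Finset.univ (δ := fun b => |rate U b x - rate U b y|)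
    (fun b _ => hα0 b) hαsum
  simp only [sq_abs] at h2
  rw [← sq_abs]
  exact (pow_le_pow_left₀ (abs_nonneg _) h1 2).trans h2

/-- Contraction of the fluctuations of the local fields, under confinement of the conditional
probabilities to an interval. -/
lemma Regular.disc_localField_le (H : Regular c T Ψ dΨ K r) (hK : 0 < K) (hr : 0 < r) (h : ι → ℝ)
    {lo hi τ θ ρ : ℝ} (hlo : 0 ≤ lo) (hlohi : lo ≤ hi) (hhi : hi ≤ 1) (hτ : 0 < τ) (hθ : θ < 1)
    (hθ' : (1 + τ) * (dΨ hi * (hi * (1 - lo))) ^ 2 ≤ θ)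
    (hρ : mean (gibbs (energyField c T h))
      (ind fun x => ∃ a, rate (energyField c T h) a x ∉ Set.Icc lo hi) ≤ ρ) (a : ι) :
    disc (gibbs (energyField c T h)) (localField c T a)
      ≤ ((1 + τ) * (2 * dΨ hi ^ 2 + 2 * K ^ 2) * ρ
        + (1 + 1 / τ) * (2 * ((2 * K ^ 5 + K ^ 3) / r))) / (1 - θ) := by
  set U := energyField c T h
  set bad := ind fun x => ∃ a, rate U a x ∉ Set.Icc lo hi with hbad
  have hw : ∀ x, 0 ≤ gibbs U x := fun x => (gibbs_pos U x).le
  have hw1 := gibbs_sum U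
  have hhi' : hi ∈ Set.Icc (0 : ℝ) 1 := ⟨hlo.trans hlohi, hhi⟩
  have hA : 0 ≤ dΨ hi := by
    obtain ⟨α, h0, h1, -⟩ := H.sq_fieldProd_sub_le U hhi' a
    exact (Finset.sum_nonneg fun b _ => h0 b).trans h1
  have hgood : ∀ x y, (∀ b, rate U b x ∈ Set.Icc lo hi) ∧ (∀ b, rate U b y ∈ Set.Icc lo hi)
      ∨ 1 ≤ bad x + bad y := by
    intro x y
    by_cases hx : ∃ a, rate U a x ∉ Set.Icc lo hi
    · right
      have h1 : bad x = 1 := if_pos hx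
      have h2 : 0 ≤ bad y := ind_nonneg _ y
      linarith
    · by_cases hy : ∃ a, rate U a y ∉ Set.Icc lo hi
      · right
        have h1 : bad y = 1 := if_pos hy
        have h2 : 0 ≤ bad x := ind_nonneg _ x
        linarith
      · left
        push Not at hx hy
        exact ⟨hx, hy⟩
  have hrate : ∀ b, disc (gibbs U) (rate U b)
      ≤ (hi * (1 - lo)) ^ 2 * disc (gibbs U) (localField c T b) + 2 * ρ := by
    intro b
    have := disc_le_sum (B := Unit) hw hw1 Finset.univ (f := rate U b) (bad := bad)
      (g := fun _ => localField c T b) (α := fun _ => (hi * (1 - lo)) ^ 2) (m := 1) fun x y => by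
        simp only [Finset.univ_unique, Finset.sum_singleton, one_mul]
        have h0 : 0 ≤ bad x + bad y := add_nonneg (ind_nonneg _ x) (ind_nonneg _ y)
        rcases hgood x y with ⟨hx, hy⟩ | hxy
        · have h1 := hx b
          have h2 := hy b
          rw [rate_energyField] at h1 h2
          have h3 := pow_le_pow_left₀ (abs_nonneg _) (abs_Phi_sub_le h1 h2) 2
          rw [sq_abs, mul_pow, sq_abs] at h3
          rw [rate_energyField, rate_energyField]
          have e : localField c T b x + h b - (localField c T b y + h b)
            = localField c T b x - localField c T b y := by ring
          rw [e] at h3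
          linarith
        · have h1 : (rate U b x - rate U b y) ^ 2 ≤ 1 := by
            rw [sq_le_one_iff_abs_le_one, abs_le]
            have := rate_nonneg (U := U) b x
            have := rate_nonneg (U := U) b y
            have := rate_le_one (U := U) b x
            have := rate_le_one (U := U) b y
            constructor <;> linarith
          have : 0 ≤ (hi * (1 - lo)) ^ 2 * (localField c T b x - localField c T b y) ^ 2 := by
            positivity
          linarith
    simp only [Finset.univ_unique, Finset.sum_singleton] at this
    linarith
  obtain ⟨m, -, hm⟩ := Finset.exists_max_image Finset.univ
    (fun b => disc (gibbs U) (localField c T b)) ⟨a, Finset.mem_univ a⟩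
  refine (hm a (Finset.mem_univ a)).trans ?_
  set D := disc (gibbs U) (localField c T m)
  have hprod : disc (gibbs U) (fieldProd c T U m)
      ≤ dΨ hi ^ 2 * ((hi * (1 - lo)) ^ 2 * D + 2 * ρ) + 2 * K ^ 2 * ρ := by
    obtain ⟨α, hα0, hα1, hα⟩ := H.sq_fieldProd_sub_le U hhi' m
    have := disc_le_sum hw hw1 Finset.univ (f := fieldProd c T U m) (bad := bad)
      (g := fun b => rate U b) (α := fun b => dΨ hi * α b) (m := K ^ 2) fun x y => by
        have h0 : 0 ≤ bad x + bad y := add_nonneg (ind_nonneg _ x) (ind_nonneg _ y)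
        have h1 : 0 ≤ ∑ b, dΨ hi * α b * (rate U b x - rate U b y) ^ 2 :=
          Finset.sum_nonneg fun b _ => mul_nonneg (mul_nonneg hA (hα0 b)) (sq_nonneg _)
        rcases hgood x y with ⟨hx, hy⟩ | hxy
        · have h2 := hα x y (fun b => (hx b).2) fun b => (hy b).2
          rw [Finset.mul_sum] at h2
          simp only [← mul_assoc] at h2
          have : 0 ≤ K ^ 2 * (bad x + bad y) := by positivity
          linarith
        · have h2 : (fieldProd c T U m x - fieldProd c T U m y) ^ 2 ≤ K ^ 2 := by
            rw [sq_le_sq, abs_of_pos hK, abs_le]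
            obtain ⟨h3, h4⟩ := H.fieldProd_mem U m x
            obtain ⟨h5, h6⟩ := H.fieldProd_mem U m y
            constructor <;> linarith
          nlinarith [sq_nonneg K]
    refine this.trans (add_le_add ?_ (by gcongr))
    have hρ0 : 0 ≤ ρ := le_trans (Finset.sum_nonneg fun x _ =>
      mul_nonneg (hw x) (ind_nonneg _ x)) hρ
    have hD0 : 0 ≤ D := disc_nonneg hw _
    calc ∑ b, dΨ hi * α b * disc (gibbs U) (rate U b)
        ≤ ∑ b, dΨ hi * α b * ((hi * (1 - lo)) ^ 2 * D + 2 * ρ) := by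
          refine Finset.sum_le_sum fun b _ =>
            mul_le_mul_of_nonneg_left ?_ (mul_nonneg hA (hα0 b))
          refine (hrate b).trans ?_
          have := hm b (Finset.mem_univ b)
          gcongr
      _ = dΨ hi * (∑ b, α b) * ((hi * (1 - lo)) ^ 2 * D + 2 * ρ) := by
          rw [Finset.mul_sum, Finset.sum_mul]
      _ ≤ dΨ hi * dΨ hi * ((hi * (1 - lo)) ^ 2 * D + 2 * ρ) := by gcongr
      _ = _ := by ring
  have hrest : disc (gibbs U) (fun x => localField c T m x - fieldProd c T U m x)
      ≤ 2 * ((2 * K ^ 5 + K ^ 3) / r) :=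
    (disc_le_two_mul hw1 _).trans
      (mul_le_mul_of_nonneg_left (H.mean_sq_localField_sub_fieldProd_le hK hr h m) zero_le_two)
  have hsplit := disc_add_le hw hw1 hτ (fieldProd c T U m)
    fun x => localField c T m x - fieldProd c T U m x
  simp only [add_sub_cancel] at hsplit
  change D ≤ _ at hsplit
  have hτ' : 0 < 1 + 1 / τ := by positivity
  have h1 := mul_le_mul_of_nonneg_left hprod (by positivity : 0 ≤ 1 + τ)
  have h2 := mul_le_mul_of_nonneg_left hrest hτ'.le
  have h3 := mul_le_mul_of_nonneg_right hθ' (disc_nonneg hw (localField c T m))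
  change _ * D ≤ _ * D at h3
  rw [le_div_iff₀ (by linarith)]
  nlinarith

end Contraction

section Variance

variable {ι J : Type*} [Fintype ι] [DecidableEq ι] [Fintype J] {c : J → ℝ} {T : J → Finset ι}
  {Ψ dΨ : ℝ → ℝ} {K r : ℝ}

lemma Regular.mean_sq_sum_spin_sub_rate_le (H : Regular c T Ψ dΨ K r) (hK : 0 < K) (hr : 0 < r)
    (h : ι → ℝ) {v : ι → ℝ} {S : ℝ} (hv : ∀ a, 0 ≤ v a) (hS : ∑ a, v a ≤ S)
    (hvS : ∀ a, v a ≤ S / r) :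
    mean (gibbs (energyField c T h))
        (fun x => (∑ a, v a * (spin (x a) - rate (energyField c T h) a x)) ^ 2)
      ≤ (1 + K) * S ^ 2 / r := by
  set U := energyField c T h
  have hS0 : 0 ≤ S := (Finset.sum_nonneg fun a _ => hv a).trans hS
  have hKr : 0 ≤ K / r := by positivity
  have e : (fun x => (∑ a, v a * (spin (x a) - rate U a x)) ^ 2) = fun x => ∑ a, v a *
      ∑ b, v b * ((spin (x a) - rate U a x) * (spin (x b) - rate U b x)) := by
    funext x
    rw [sq, Finset.sum_mul_sum]
    refine Finset.sum_congr rfl fun a _ => ?_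
    rw [Finset.mul_sum]
    exact Finset.sum_congr rfl fun b _ => by ring
  rw [e]
  simp only [mean_sum, mean_const_mul]
  have habs : ∀ a x, |spin (x a) - rate U a x| ≤ 1 := fun a x => by
    have h1 := rate_nonneg (U := U) a x
    have h2 := rate_le_one (U := U) a x
    have h3 := spin_nonneg (x a)
    have h4 := spin_le_one (x a)
    rw [abs_le]
    constructor <;> linarith
  have hpair : ∀ a b, mean (gibbs U)
      (fun x => (spin (x a) - rate U a x) * (spin (x b) - rate U b x))
        ≤ (if a = b then 1 else 0) + K / r := by
    intro a b
    split_ifs with hab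
    · have h1 := (abs_le.1 (abs_mean_le (fun x => (gibbs_pos U x).le) (gibbs_sum U)
        (f := fun x => (spin (x a) - rate U a x) * (spin (x b) - rate U b x)) (L := 1)
        fun x => by
          rw [abs_mul]
          exact mul_le_one₀ (habs a x) (abs_nonneg _) (habs b x))).2
      linarith
    · rw [zero_add]
      refine (le_abs_self _).trans (abs_mean_spin_sub_rate_mul_le U a
        (g := fun x => spin (x b) - rate U b x) fun x => ?_)
      have e : ddiff a (fun x => spin (x b) - rate U b x) x = -ddiff a (rate U b) x := by
        simp only [ddiff, Function.update_of_ne (Ne.symm hab)]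
        ring
      rw [e, abs_neg]
      exact H.abs_ddiff_rate_le hK hr h b a x
  have hrow : ∀ a, ∑ b, v b * mean (gibbs U)
      (fun x => (spin (x a) - rate U a x) * (spin (x b) - rate U b x))
        ≤ S / r + S * (K / r) := by
    intro a
    refine (Finset.sum_le_sum fun b _ => mul_le_mul_of_nonneg_left (hpair a b) (hv b)).trans ?_
    simp only [mul_add, Finset.sum_add_distrib, mul_ite, mul_one, mul_zero, Finset.sum_ite_eq,
      Finset.mem_univ, if_true, ← Finset.sum_mul]
    exact add_le_add (hvS a) (mul_le_mul_of_nonneg_right hS hKr)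
  calc ∑ a, v a * ∑ b, v b * mean (gibbs U)
        (fun x => (spin (x a) - rate U a x) * (spin (x b) - rate U b x))
      ≤ ∑ a, v a * (S / r + S * (K / r)) :=
        Finset.sum_le_sum fun a _ => mul_le_mul_of_nonneg_left (hrow a) (hv a)
    _ = (∑ a, v a) * (S / r + S * (K / r)) := by rw [Finset.sum_mul]
    _ ≤ S * (S / r + S * (K / r)) := by gcongr
    _ = _ := by ring

lemma Regular.disc_sum_spin_le (H : Regular c T Ψ dΨ K r) (hK : 0 < K) (hr : 0 < r)
    (h : ι → ℝ) {v : ι → ℝ} {S : ℝ} (hv : ∀ a, 0 ≤ v a) (hS : ∑ a, v a ≤ S)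
    (hvS : ∀ a, v a ≤ S / r) {D : ℝ} (hD0 : 0 ≤ D)
    (hD : ∀ a, disc (gibbs (energyField c T h)) (localField c T a) ≤ D / r) :
    disc (gibbs (energyField c T h)) (fun x => ∑ a, v a * spin (x a))
      ≤ (2 * D + 4 * (1 + K)) * S ^ 2 / r := by
  set U := energyField c T h
  have hw : ∀ x, 0 ≤ gibbs U x := fun x => (gibbs_pos U x).le
  have hw1 := gibbs_sum U
  have hS0 : 0 ≤ S := (Finset.sum_nonneg fun a _ => hv a).trans hS
  have hrate : disc (gibbs U) (fun x => ∑ a, v a * rate U a x) ≤ S ^ 2 * (D / r) := by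
    have := disc_le_sum hw hw1 Finset.univ (f := fun x => ∑ a, v a * rate U a x)
      (bad := fun _ => 0) (g := localField c T) (α := fun a => S * v a) (m := 0) fun x y => by
        simp only [← Finset.sum_sub_distrib, ← mul_sub, zero_mul, add_zero]
        refine (sq_sum_mul_le Finset.univ (fun a _ => hv a) hS).trans ?_
        simp only [mul_assoc, ← Finset.mul_sum]
        refine mul_le_mul_of_nonneg_left (Finset.sum_le_sum fun a _ =>
          mul_le_mul_of_nonneg_left ?_ (hv a)) hS0
        rw [rate_energyField, rate_energyField]
        refine sq_le_sq.2 ((abs_Phi_sub_le_abs _ _).trans (le_of_eq ?_))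
        congr 1; ring
    refine this.trans ?_
    simp only [mul_zero, zero_mul, add_zero, mul_assoc, ← Finset.mul_sum]
    calc S * ∑ a, v a * disc (gibbs U) (localField c T a)
        ≤ S * ∑ a, v a * (D / r) := mul_le_mul_of_nonneg_left
          (Finset.sum_le_sum fun a _ => mul_le_mul_of_nonneg_left (hD a) (hv a)) hS0
      _ = S * ((∑ a, v a) * (D / r)) := by rw [Finset.sum_mul]
      _ ≤ S * (S * (D / r)) := by
          have : 0 ≤ D / r := by positivity
          gcongr
      _ = _ := by ring
  have hsplit := disc_add_le hw hw1 one_pos (fun x => ∑ a, v a * rate U a x)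
    fun x => ∑ a, v a * (spin (x a) - rate U a x)
  have hrest := (disc_le_two_mul hw1 fun x => ∑ a, v a * (spin (x a) - rate U a x)).trans
    (mul_le_mul_of_nonneg_left (H.mean_sq_sum_spin_sub_rate_le hK hr h hv hS hvS) zero_le_two)
  simp only [← Finset.sum_add_distrib, ← mul_add, add_sub_cancel] at hsplit
  refine hsplit.trans ?_
  have e : (2 * D + 4 * (1 + K)) * S ^ 2 / r
      = 2 * (S ^ 2 * (D / r)) + 2 * (2 * ((1 + K) * S ^ 2 / r)) := by ring
  rw [e]
  norm_num
  linarith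

end Variance

/-- In the sub-critical regime, linear statistics with coefficients of order `1/r` have variance of
order `1/r`, uniformly over small external fields. -/
lemma MeanFieldSubcritical.exists_disc_le {Ψ dΨ : ℝ → ℝ} {p K : ℝ}
    (M : MeanFieldSubcritical Ψ dΨ p) (hK : 0 < K) :
    ∃ δ > 0, ∃ C > 0, ∃ N : ℝ, ∀ r ≥ N, ∀ (ι J : Type) [Fintype ι] [DecidableEq ι] [Fintype J]
      (c : J → ℝ) (T : J → Finset ι), Regular c T Ψ dΨ K r → ∀ h : ι → ℝ, (∀ a, |h a| ≤ δ) →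
      ∀ (v : ι → ℝ) (S : ℝ), (∀ a, 0 ≤ v a) → ∑ a, v a ≤ S → (∀ a, v a ≤ S / r) →
        disc (gibbs (energyField c T h)) (fun x => ∑ a, v a * spin (x a)) ≤ C * S ^ 2 / r := by
  have hp0 : 0 < p := M.fixed ▸ Phi_pos _
  have hp1 : p < 1 := M.fixed ▸ Phi_lt_one _
  obtain ⟨t, ht, hcond⟩ : ∃ t > 0, t < p ∧ t < 1 - p ∧
      (1 + t) * (dΨ (p + t) * ((p + t) * (1 - (p - t)))) ^ 2 < 1 := by
    have hcont : Continuous fun t : ℝ =>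
        (1 + t) * (dΨ (p + t) * ((p + t) * (1 - (p - t)))) ^ 2 := by
      have := M.continuous_slope
      fun_prop
    have h0 : (fun t : ℝ => (1 + t) * (dΨ (p + t) * ((p + t) * (1 - (p - t)))) ^ 2) 0 < 1 := by
      have h1 := M.slope_lt
      have h2 := M.slope_nonneg p ⟨hp0.le, hp1.le⟩
      have h3 : 0 ≤ dΨ p * (p * (1 - p)) := mul_nonneg h2 (mul_nonneg hp0.le (by linarith))
      have h4 : dΨ p * (p * (1 - p)) < 1 := by linarith
      simpa using (pow_lt_one₀ h3 h4 two_ne_zero)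
    have hev := (hcont.tendsto 0).eventually_lt_const h0
    have hev2 : ∀ᶠ t : ℝ in nhds 0, t < p := eventually_lt_nhds hp0
    have hev3 : ∀ᶠ t : ℝ in nhds 0, t < 1 - p := eventually_lt_nhds (by linarith)
    have hall := (hev2.and (hev3.and hev)).filter_mono (nhdsWithin_le_nhds (s := Set.Ioi 0))
    obtain ⟨t, h, ht⟩ := (hall.and self_mem_nhdsWithin).exists
    exact ⟨t, ht, h⟩
  obtain ⟨htp, ht1, hlt⟩ := hcond
  set θ := (1 + t) * (dΨ (p + t) * ((p + t) * (1 - (p - t)))) ^ 2 with hθ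
  obtain ⟨δ₁, hδ₁, κ₁, hκ₁, N₁, hN₁⟩ := M.confined hK (σ := 1) (Or.inl rfl) ht
  obtain ⟨δ₂, hδ₂, κ₂, hκ₂, N₂, hN₂⟩ := M.confined hK (σ := -1) (Or.inr rfl) ht
  set κ := min κ₁ κ₂ with hκdef
  have hκ : 0 < κ := lt_min hκ₁ hκ₂
  set D := ((1 + t) * (2 * dΨ (p + t) ^ 2 + 2 * K ^ 2) * (2 / κ)
    + (1 + 1 / t) * (2 * (2 * K ^ 5 + K ^ 3))) / (1 - θ) with hD
  have hθ1 : 0 < 1 - θ := by linarith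
  have hD0 : 0 < D := by positivity
  refine ⟨min δ₁ δ₂, lt_min hδ₁ hδ₂, 2 * D + 4 * (1 + K), by positivity, max 1 (max N₁ N₂),
    fun r hr ι J _ _ _ c T H h hh v S hv hS hvS => ?_⟩
  have hr0 : 0 < r := lt_of_lt_of_le one_pos ((le_max_left _ _).trans hr)
  refine H.disc_sum_spin_le hK hr0 h hv hS hvS hD0.le fun a => ?_
  have h1 := hN₁ r ((le_max_left _ _).trans ((le_max_right _ _).trans hr)) ι J c T H h
    fun a => (hh a).trans (min_le_left _ _)
  have h2 := hN₂ r ((le_max_right _ _).trans ((le_max_right _ _).trans hr)) ι J c T H h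
    fun a => (hh a).trans (min_le_right _ _)
  have hexp : ∀ k, κ ≤ k → Real.exp (-k * r) ≤ 1 / κ / r := by
    intro k hk
    have h3 : Real.exp (-k * r) ≤ Real.exp (-(κ * r)) := Real.exp_le_exp.2 (by nlinarith)
    refine h3.trans ?_
    rw [Real.exp_neg, div_div, one_div]
    exact inv_anti₀ (by positivity) (by linarith [Real.add_one_le_exp (κ * r)])
  have hbad : mean (gibbs (energyField c T h)) (ind fun x => ∃ a,
      rate (energyField c T h) a x ∉ Set.Icc (p - t) (p + t)) ≤ 2 / κ / r := by
    have h3 : ∀ x, ind (fun x => ∃ a, rate (energyField c T h) a x ∉ Set.Icc (p - t) (p + t)) x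
        ≤ ind (fun x => ∃ a, 0 < (1 : ℝ) * (rate (energyField c T h) a x - (p + 1 * t))) x
          + ind (fun x => ∃ a, 0 < (-1 : ℝ) * (rate (energyField c T h) a x - (p + -1 * t))) x := by
      intro x
      by_cases hx : ∃ a, rate (energyField c T h) a x ∉ Set.Icc (p - t) (p + t)
      · obtain ⟨b, hb⟩ := hx
        rw [Set.mem_Icc, not_and_or, not_le, not_le] at hb
        refine (ind_le_one _ _).trans ?_
        rcases hb with hb | hb
        · refine le_add_of_nonneg_of_le (ind_nonneg _ _) (le_of_eq ?_)
          exact (if_pos ⟨b, by linarith⟩).symm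
        · refine le_add_of_le_of_nonneg (le_of_eq ?_) (ind_nonneg _ _)
          exact (if_pos ⟨b, by linarith⟩).symm
      · rw [ind, if_neg hx]
        exact add_nonneg (ind_nonneg _ _) (ind_nonneg _ _)
    refine (mean_mono (fun x => (gibbs_pos _ x).le) h3).trans ?_
    rw [mean_add]
    refine (add_le_add (h1.trans (hexp κ₁ (min_le_left _ _)))
      (h2.trans (hexp κ₂ (min_le_right _ _)))).trans (le_of_eq ?_)
    ring
  refine (H.disc_localField_le hK hr0 h (by linarith) (by linarith) (by linarith) ht hlt le_rfl
    hbad a).trans (le_of_eq ?_)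
  rw [hD]
  ring

section Tilting

variable {ι : Type*} [Fintype ι] [DecidableEq ι]

lemma mean_gibbs_tilt (U F f : (ι → Bool) → ℝ) (t : ℝ) :
    mean (gibbs fun x => U x + t * F x) f
      = mean (gibbs U) (fun x => f x * Real.exp (t * F x))
        / mean (gibbs U) (fun x => Real.exp (t * F x)) := by
  have key : ∀ g : (ι → Bool) → ℝ, mean (gibbs U) (fun x => g x * Real.exp (t * F x))
      = (∑ x, Real.exp (U x + t * F x) * g x) / ∑ y, Real.exp (U y) := by
    intro g
    simp only [mean, gibbs, Finset.sum_div]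
    exact Finset.sum_congr rfl fun x _ => by rw [Real.exp_add]; ring
  have h1 := key fun _ => 1
  simp only [one_mul, mul_one] at h1
  have hZ : (∑ y, Real.exp (U y)) ≠ 0 :=
    (Finset.sum_pos (fun _ _ => Real.exp_pos _) Finset.univ_nonempty).ne'
  rw [key, h1, div_div_div_cancel_right₀ hZ, mean, Finset.sum_div]
  exact Finset.sum_congr rfl fun x _ => by rw [gibbs]; ring

lemma hasDerivAt_mean_mul_exp (w F g : (ι → Bool) → ℝ) (t : ℝ) :
    HasDerivAt (fun t => mean w fun x => g x * Real.exp (t * F x))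
      (mean w fun x => g x * F x * Real.exp (t * F x)) t := by
  unfold mean
  refine HasDerivAt.fun_sum fun x _ => ?_
  have h := ((((hasDerivAt_id t).mul_const (F x)).exp).const_mul (g x)).const_mul (w x)
  refine h.congr_deriv ?_
  simp only [id]
  ring

/-- A variance bound along the exponential tilts by `F` gives a sub-Gaussian moment generating
function. -/
lemma mean_exp_le_of_disc_le (U F : (ι → Bool) → ℝ) {k Θ : ℝ}
    (h : ∀ t ∈ Set.Icc 0 Θ, disc (gibbs fun x => U x + t * F x) F ≤ 2 * k) {θ : ℝ}
    (hθ : θ ∈ Set.Icc 0 Θ) :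
    mean (gibbs U) (fun x => Real.exp (θ * (F x - mean (gibbs U) F)))
      ≤ Real.exp (k * θ ^ 2 / 2) := by
  set A : ℝ → ℝ := fun t => mean (gibbs U) fun x => Real.exp (t * F x) with hA
  set B : ℝ → ℝ := fun t => mean (gibbs U) fun x => F x * Real.exp (t * F x) with hB
  set E : ℝ → ℝ := fun t => mean (gibbs U) fun x => F x ^ 2 * Real.exp (t * F x) with hE
  have hApos : ∀ t, 0 < A t := fun t =>
    Finset.sum_pos (fun x _ => mul_pos (gibbs_pos U x) (Real.exp_pos _)) Finset.univ_nonempty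
  have hA' : ∀ t, HasDerivAt A (B t) t := fun t => by
    simpa using hasDerivAt_mean_mul_exp (gibbs U) F (fun _ => 1) t
  have hB' : ∀ t, HasDerivAt B (E t) t := fun t => by
    simpa [← sq] using hasDerivAt_mean_mul_exp (gibbs U) F F t
  have hA0 : A 0 = 1 := by simp [hA, mean_const (gibbs_sum U)]
  have hB0 : B 0 = mean (gibbs U) F := by simp [hB]
  have hΘ : 0 ≤ Θ := hθ.1.trans hθ.2
  have h0 : (0 : ℝ) ∈ Set.Icc 0 Θ := ⟨le_rfl, hΘ⟩
  have hm' : ∀ t, HasDerivAt (fun t => B t / A t - k * t)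
      ((E t * A t - B t * B t) / A t ^ 2 - k) t := fun t => by
    have h1 := ((hB' t).div (hA' t) (hApos t).ne').fun_sub ((hasDerivAt_id t).const_mul k)
    rwa [mul_one] at h1
  have hm : AntitoneOn (fun t => B t / A t - k * t) (Set.Icc 0 Θ) := by
    refine antitoneOn_of_deriv_nonpos (convex_Icc _ _)
      (fun t _ => (hm' t).continuousAt.continuousWithinAt)
      (fun t _ => (hm' t).differentiableAt.differentiableWithinAt) fun t ht => ?_
    rw [(hm' t).deriv]
    have h1 := h t (interior_subset ht)
    rw [disc_eq (gibbs_sum _), mean_gibbs_tilt, mean_gibbs_tilt] at h1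
    change 2 * (E t / A t - (B t / A t) ^ 2) ≤ 2 * k at h1
    have h2 : (E t * A t - B t * B t) / A t ^ 2 = E t / A t - (B t / A t) ^ 2 := by
      have := (hApos t).ne'
      field_simp
    linarith
  set m := mean (gibbs U) F
  have hg' : ∀ t, HasDerivAt (fun t => A t * Real.exp (-(t * m) - k * t ^ 2 / 2))
      ((B t - (m + k * t) * A t) * Real.exp (-(t * m) - k * t ^ 2 / 2)) t := fun t => by
    have h1 : HasDerivAt (fun t : ℝ => -(t * m) - k * t ^ 2 / 2) (-m - k * t) t := by
      have := (((hasDerivAt_id t).mul_const m).neg).sub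
        (((hasDerivAt_pow 2 t).const_mul k).div_const 2)
      refine this.congr_deriv ?_
      norm_num
      ring
    refine ((hA' t).mul h1.exp).congr_deriv ?_
    ring
  have hg : AntitoneOn (fun t => A t * Real.exp (-(t * m) - k * t ^ 2 / 2)) (Set.Icc 0 Θ) := by
    refine antitoneOn_of_deriv_nonpos (convex_Icc _ _)
      (fun t _ => (hg' t).continuousAt.continuousWithinAt)
      (fun t _ => (hg' t).differentiableAt.differentiableWithinAt) fun t ht => ?_
    rw [(hg' t).deriv]
    refine mul_nonpos_of_nonpos_of_nonneg ?_ (Real.exp_pos _).le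
    have ht' := interior_subset ht
    have h1 : B t / A t - k * t ≤ B 0 / A 0 - k * 0 := hm h0 ht' ht'.1
    rw [hA0, hB0] at h1
    have h2 : B t / A t ≤ m + k * t := by linarith
    rw [div_le_iff₀ (hApos t)] at h2
    linarith
  have hfin : A θ * Real.exp (-(θ * m) - k * θ ^ 2 / 2)
      ≤ A 0 * Real.exp (-(0 * m) - k * 0 ^ 2 / 2) := hg h0 hθ hθ.1
  rw [hA0] at hfin
  have e : mean (gibbs U) (fun x => Real.exp (θ * (F x - m))) = A θ * Real.exp (-(θ * m)) := by
    rw [mul_comm, hA, ← mean_const_mul]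
    congr 1
    funext x
    rw [← Real.exp_add]
    congr 1; ring
  rw [e]
  rw [Real.exp_sub, mul_div_assoc', div_le_iff₀ (Real.exp_pos _)] at hfin
  simpa using hfin

/-- Chernoff bound. -/
lemma mean_ind_abs_sub_le {w f : (ι → Bool) → ℝ} (hw : ∀ x, 0 ≤ w x) (m : ℝ) {θ ε E : ℝ}
    (hθ : 0 ≤ θ) (h1 : mean w (fun x => Real.exp (θ * (f x - m))) ≤ E)
    (h2 : mean w (fun x => Real.exp (-θ * (f x - m))) ≤ E) :
    mean w (ind fun x => ε < |f x - m|) ≤ 2 * (Real.exp (-(θ * ε)) * E) := by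
  have h : ∀ x, ind (fun x => ε < |f x - m|) x ≤ Real.exp (-(θ * ε)) *
      (Real.exp (θ * (f x - m)) + Real.exp (-θ * (f x - m))) := by
    intro x
    by_cases hx : ε < |f x - m|
    · refine (ind_le_one _ _).trans ?_
      have h3 := Real.exp_pos (-(θ * ε) + θ * (f x - m))
      have h4 := Real.exp_pos (-(θ * ε) + -θ * (f x - m))
      rw [mul_add, ← Real.exp_add, ← Real.exp_add]
      rcases lt_abs.1 hx with h | h
      · have := Real.one_le_exp (x := -(θ * ε) + θ * (f x - m)) (by nlinarith)
        linarith
      · have := Real.one_le_exp (x := -(θ * ε) + -θ * (f x - m)) (by nlinarith)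
        linarith
    · rw [ind, if_neg hx]
      positivity
  refine (mean_mono hw h).trans ?_
  rw [mean_const_mul, mean_add]
  nlinarith [Real.exp_pos (-(θ * ε))]

end Tilting

section Association

variable {ι : Type*} [Fintype ι] [DecidableEq ι]

lemma monotone_of_ddiff_nonneg {f : (ι → Bool) → ℝ} (h : ∀ a x, 0 ≤ ddiff a f x) :
    Monotone f := by
  intro x y hxy
  have key : ∀ s : Finset ι, f x ≤ f (s.piecewise y x) := by
    intro s
    induction s using Finset.induction_on with
    | empty => simp
    | insert a s ha ih =>
      rw [Finset.piecewise_insert]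
      refine ih.trans ?_
      set z := s.piecewise y x with hz
      have hza : z a = x a := Finset.piecewise_eq_of_notMem _ _ _ ha
      have hle := hxy a
      have hself := Function.update_eq_self a z
      cases hy : y a
      · rw [hy] at hle
        rw [hza, Bool.eq_false_of_le_false hle] at hself
        rw [hself]
      · have h1 := sub_nonneg.1 (h a z)
        cases hx : x a
        · rw [hza, hx] at hself
          rwa [hself] at h1
        · rw [hza, hx] at hself
          rw [hself]
  simpa using key Finset.univ

/-- The FKG inequality for functions of arbitrary sign. -/
lemma mean_mul_mean_le {w f g : (ι → Bool) → ℝ} (hw : ∀ x, 0 ≤ w x) (hw1 : ∑ x, w x = 1)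
    (hlog : ∀ x y, w x * w y ≤ w (x ⊓ y) * w (x ⊔ y)) (hf : Monotone f) (hg : Monotone g) :
    mean w f * mean w g ≤ mean w fun x => f x * g x := by
  have h := fkg (μ := w) (f := fun x => f x - f ⊥) (g := fun x => g x - g ⊥) hw
    (fun x => sub_nonneg.2 (hf bot_le)) (fun x => sub_nonneg.2 (hg bot_le))
    (fun x y hxy => sub_le_sub_right (hf hxy) _) (fun x y hxy => sub_le_sub_right (hg hxy) _) hlog
  rw [hw1, one_mul] at h
  change mean w (fun x => f x - f ⊥) * mean w (fun x => g x - g ⊥)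
    ≤ mean w (fun x => (f x - f ⊥) * (g x - g ⊥)) at h
  have e : (fun x => (f x - f ⊥) * (g x - g ⊥))
      = fun x => f x * g x + ((-g ⊥) * f x + ((-f ⊥) * g x + f ⊥ * g ⊥)) := by
    funext x; ring
  rw [e] at h
  simp only [sub_eq_add_neg, mean_add, mean_const_mul, mean_const hw1] at h
  linarith

/-- If `f` and `F - f` are increasing then `F` has the larger centred moment generating function. -/
lemma mean_exp_le_mean_exp {w f F : (ι → Bool) → ℝ} (hw : ∀ x, 0 ≤ w x) (hw1 : ∑ x, w x = 1)
    (hlog : ∀ x y, w x * w y ≤ w (x ⊓ y) * w (x ⊔ y)) (hf : Monotone f)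
    (hF : Monotone fun x => F x - f x) (θ : ℝ) :
    mean w (fun x => Real.exp (θ * (f x - mean w f)))
      ≤ mean w fun x => Real.exp (θ * (F x - mean w F)) := by
  set G := fun x => F x - f x with hG
  set e := fun x => Real.exp (θ * (f x - mean w f)) with he
  have hmG : mean w G = mean w F - mean w f := by
    simp only [hG, mean, mul_sub, Finset.sum_sub_distrib]
  have hcov : 0 ≤ θ * (mean w (fun x => e x * G x) - mean w e * mean w G) := by
    rcases le_total 0 θ with h | h
    · refine mul_nonneg h (sub_nonneg.2 (mean_mul_mean_le hw hw1 hlog ?_ hF))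
      intro x y hxy
      exact Real.exp_le_exp.2 (mul_le_mul_of_nonneg_left (sub_le_sub_right (hf hxy) _) h)
    · have h1 := mean_mul_mean_le hw hw1 hlog (f := fun x => -1 * e x) (fun x y hxy => by
        have : e y ≤ e x :=
          Real.exp_le_exp.2 (mul_le_mul_of_nonpos_left (sub_le_sub_right (hf hxy) _) h)
        linarith) hF
      simp only [mul_assoc, mean_const_mul] at h1
      exact mul_nonneg_of_nonpos_of_nonpos h (by linarith)
  have hpt : ∀ x, e x + (θ * (e x * G x) + (-(θ * mean w G)) * e x)
      ≤ Real.exp (θ * (F x - mean w F)) := by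
    intro x
    have h1 := Real.add_one_le_exp (θ * (G x - mean w G))
    have h2 : Real.exp (θ * (F x - mean w F)) = e x * Real.exp (θ * (G x - mean w G)) := by
      rw [he, ← Real.exp_add, hmG]
      congr 1
      simp only [hG]
      ring
    rw [h2]
    nlinarith [Real.exp_pos (θ * (f x - mean w f))]
  have h3 := mean_mono hw hpt
  simp only [mean_add, mean_const_mul] at h3
  linarith

omit [Fintype ι] [DecidableEq ι] in
lemma monom_eq_ite (T : Finset ι) (x : ι → Bool) [Decidable (∀ b ∈ T, x b = true)] :
    monom T x = if ∀ b ∈ T, x b = true then 1 else 0 := by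
  simp only [monom, spin, Finset.prod_boole]
  congr

omit [Fintype ι] [DecidableEq ι] in
lemma monom_add_le (T : Finset ι) (x y : ι → Bool) :
    monom T x + monom T y ≤ monom T (x ⊓ y) + monom T (x ⊔ y) := by
  classical
  have key : ∀ x y : ι → Bool, (∀ b ∈ T, x b = true) →
      monom T x + monom T y ≤ monom T (x ⊓ y) + monom T (x ⊔ y) := by
    intro x y hx
    have h1 : monom T (x ⊓ y) = monom T y :=
      Finset.prod_congr rfl fun b hb => by simp [hx b hb]
    have h2 : monom T (x ⊔ y) = 1 := Finset.prod_eq_one fun b hb => by simp [hx b hb]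
    have h3 := monom_le_one T x
    linarith
  by_cases hx : ∀ b ∈ T, x b = true
  · exact key x y hx
  by_cases hy : ∀ b ∈ T, y b = true
  · rw [add_comm, inf_comm, sup_comm]
    exact key y x hy
  rw [monom_eq_ite T x, monom_eq_ite T y, if_neg hx, if_neg hy, add_zero]
  exact add_nonneg (monom_nonneg _ _) (monom_nonneg _ _)

lemma gibbs_mul_le {J : Type*} [Fintype J] {c : J → ℝ} (hc : ∀ j, 0 ≤ c j) (T : J → Finset ι)
    (x y : ι → Bool) : gibbs (energy c T) x * gibbs (energy c T) y
      ≤ gibbs (energy c T) (x ⊓ y) * gibbs (energy c T) (x ⊔ y) := by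
  simp only [gibbs, div_mul_div_comm, ← Real.exp_add]
  refine div_le_div_of_nonneg_right (Real.exp_le_exp.2 ?_) ?_
  · simp only [energy, ← Finset.sum_add_distrib, ← mul_add]
    exact Finset.sum_le_sum fun j _ => mul_le_mul_of_nonneg_left (monom_add_le _ _ _) (hc j)
  · exact mul_self_nonneg _

end Association

/-- In the sub-critical regime, the local fields are sub-Gaussian with variance proxy of order
`1/r`. -/
theorem MeanFieldSubcritical.concentration {Ψ dΨ : ℝ → ℝ} {p K : ℝ}
    (M : MeanFieldSubcritical Ψ dΨ p) (hK : 0 < K) :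
    ∃ k > 0, ∃ N : ℝ, ∀ r ≥ N, ∀ (ι J : Type) [Fintype ι] [DecidableEq ι] [Fintype J]
      (c : J → ℝ) (T : J → Finset ι), Regular c T Ψ dΨ K r → ∀ (a : ι) (ε : ℝ), 0 < ε →
        mean (gibbs (energy c T)) (ind fun x => ε <
          |localField c T a x - mean (gibbs (energy c T)) (localField c T a)|)
          ≤ 2 * Real.exp (-k * r * ε ^ 2) := by
  obtain ⟨δ, hδ, C, hC, N, hN⟩ := M.exists_disc_le hK
  set S := K ^ 2 + K with hS
  have hS0 : 0 < S := by positivity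
  set l := min (1 / (C * S ^ 2)) (δ / K / K) with hl
  have hl0 : 0 < l := lt_min (by positivity) (by positivity)
  refine ⟨l / 2, by positivity, max 1 N, fun r hr ι J _ _ _ c T H a ε hε => ?_⟩
  have hr0 : 0 < r := lt_of_lt_of_le one_pos ((le_max_left _ _).trans hr)
  have hw : ∀ x, 0 ≤ gibbs (energy c T) x := fun x => (gibbs_pos _ x).le
  have hw1 := gibbs_sum (energy c T)
  set f := localField c T a with hf
  set m := mean (gibbs (energy c T)) f with hm
  have hf0 : ∀ x, 0 ≤ f x := localField_nonneg H.coeff_nonneg a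
  have hfK : ∀ x, f x ≤ K := fun x => (localField_le H.coeff_nonneg a x).trans (H.weight_le a)
  have hm0 : 0 ≤ m := (mean_const hw1 0).symm.le.trans (mean_mono hw hf0)
  have hmK : m ≤ K := (mean_mono hw hfK).trans (mean_const hw1 K).le
  rcases le_or_gt K ε with hεK | hεK
  · have h0 : ∀ x, ind (fun x => ε < |f x - m|) x ≤ 0 := fun x => by
      refine (if_neg (not_lt.2 ?_)).le
      have h1 := hf0 x
      have h2 := hfK x
      rw [abs_le]
      constructor <;> linarith
    refine (mean_mono hw h0).trans ?_
    rw [mean_const hw1]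
    positivity
  set v : ι → ℝ := fun b => if b = a then 0 else infl c T a b with hv
  have hv0 : ∀ b, 0 ≤ v b := fun b => by
    have := infl_nonneg (T := T) H.coeff_nonneg a b
    simp only [hv]; split_ifs <;> simp [this]
  have hvr : ∀ b, v b ≤ K / r := fun b => by
    simp only [hv]
    split_ifs with hb
    · positivity
    · exact H.infl_le a b (Ne.symm hb)
  have hvS : ∑ b, v b ≤ S := by
    refine (Finset.sum_le_sum fun b _ => ?_).trans ((H.sum_infl_le a).trans (by linarith))
    have := infl_nonneg (T := T) H.coeff_nonneg a b
    simp only [hv]; split_ifs <;> simp [this]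
  have hvS' : ∀ b, v b ≤ S / r := fun b =>
    (hvr b).trans (div_le_div_of_nonneg_right (by rw [hS]; nlinarith) hr0.le)
  set F : (ι → Bool) → ℝ := fun x => ∑ b, v b * spin (x b) with hF
  have hdisc : ∀ t, |t| ≤ δ * r / K →
      disc (gibbs fun x => energy c T x + t * F x) F ≤ C * S ^ 2 / r := by
    intro t ht
    have := hN r ((le_max_right _ _).trans hr) ι J c T H (fun b => t * v b) (fun b => by
      rw [abs_mul, abs_of_nonneg (hv0 b)]
      refine (mul_le_mul ht (hvr b) (hv0 b) (by positivity)).trans (le_of_eq ?_)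
      field_simp) v S hv0 hvS hvS'
    have e : energyField c T (fun b => t * v b) = fun x => energy c T x + t * F x := by
      funext x
      simp only [energyField, hF, Finset.mul_sum, mul_assoc]
    rwa [e] at this
  have hmono : Monotone f :=
    monotone_of_ddiff_nonneg fun b x => ddiff_localField_nonneg H.coeff_nonneg a b x
  have hmono' : Monotone fun x => F x - f x := by
    refine monotone_of_ddiff_nonneg fun b x => ?_
    have e : ddiff b (fun x => F x - f x) x = ddiff b F x - ddiff b f x := by
      simp only [ddiff]; ring
    rw [e, hF, ddiff_linear, sub_nonneg]
    by_cases hb : b = a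
    · simp [hv, hf, hb, ddiff_localField_self]
    · simp only [hv, if_neg hb]
      exact ddiff_localField_le H.coeff_nonneg x
  set θ := l * r * ε with hθ
  have hθ0 : 0 ≤ θ := by positivity
  have hθ1 : θ ≤ δ * r / K := by
    have h1 : l * ε ≤ δ / K / K * K :=
      mul_le_mul (min_le_right _ _) hεK.le hε.le (by positivity)
    have h2 : δ / K / K * K = δ / K := by field_simp
    rw [h2] at h1
    calc θ = l * ε * r := by ring
      _ ≤ δ / K * r := by gcongr
      _ = _ := by ring
  have hmgf : ∀ σ : ℝ, σ = 1 ∨ σ = -1 →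
      mean (gibbs (energy c T)) (fun x => Real.exp (σ * θ * (f x - m)))
        ≤ Real.exp (C * S ^ 2 / r / 2 * θ ^ 2 / 2) := by
    intro σ hσ
    refine (mean_exp_le_mean_exp hw hw1 (gibbs_mul_le H.coeff_nonneg T) hmono hmono' _).trans ?_
    have hσ2 : σ ^ 2 = 1 := by rcases hσ with h | h <;> rw [h] <;> norm_num
    have habs : |σ| = 1 := by rcases hσ with h | h <;> rw [h] <;> simp
    have h1 := mean_exp_le_of_disc_le (energy c T) (fun x => σ * F x) (k := C * S ^ 2 / r / 2)
      (Θ := δ * r / K) (fun t ht => by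
        have h2 := hdisc (t * σ) (by rw [abs_mul, habs, mul_one, abs_of_nonneg ht.1]; exact ht.2)
        have e : ∀ w : (ι → Bool) → ℝ, disc w (fun x => σ * F x) = disc w F := fun w => by
          simp only [disc, ← mul_sub, mul_pow, hσ2, one_mul]
        rw [e]
        simp only [← mul_assoc]
        linarith) ⟨hθ0, hθ1⟩
    rw [mean_const_mul] at h1
    refine le_trans (le_of_eq ?_) h1
    congr 1
    funext x
    congr 1; ring
  have h1 := hmgf 1 (Or.inl rfl)
  have h2 := hmgf (-1) (Or.inr rfl)
  rw [one_mul] at h1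
  rw [neg_one_mul] at h2
  refine (mean_ind_abs_sub_le hw m hθ0 h1 h2).trans ?_
  rw [← Real.exp_add]
  refine mul_le_mul_of_nonneg_left (Real.exp_le_exp.2 ?_) zero_le_two
  have h3 : C * S ^ 2 * l ≤ 1 := by
    have := min_le_left (1 / (C * S ^ 2)) (δ / K / K)
    rw [← hl, le_div_iff₀ (by positivity)] at this
    linarith
  have e : C * S ^ 2 / r / 2 * θ ^ 2 / 2 = (C * S ^ 2 * l) * (l * r * ε ^ 2 / 4) := by
    rw [hθ]; field_simp; ring
  have h4 : (C * S ^ 2 * l) * (l * r * ε ^ 2 / 4) ≤ 1 * (l * r * ε ^ 2 / 4) := by gcongr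
  have h5 : 0 ≤ l * r * ε ^ 2 := by positivity
  rw [e, hθ]
  nlinarith

section SubgraphCounts

variable {n m : ℕ} (G : SimpleGraph (Fin m))

open scoped Classical in
/-- The edges of the copy of `G` given by `ψ`. -/
noncomputable def edgeImage (ψ : Fin m ↪ Fin n) : Finset (EdgeSet n) :=
  {e | ∃ g ∈ G.edgeSet, Sym2.map ψ g = e.1}

variable {G} in
lemma mem_edgeImage {ψ : Fin m ↪ Fin n} {e : EdgeSet n} :
    e ∈ edgeImage G ψ ↔ ∃ g ∈ G.edgeSet, Sym2.map ψ g = e.1 := by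
  simp [edgeImage]

lemma card_edgeImage (ψ : Fin m ↪ Fin n) : (edgeImage G ψ).card = numEdges G := by
  rw [numEdges, ← Set.ncard_image_of_injective _ (Sym2.map.injective ψ.injective),
    ← Finset.card_map (Function.Embedding.subtype _), ← Set.ncard_coe_finset]
  congr 1
  ext z
  simp only [Finset.coe_map, Set.mem_image, Finset.mem_coe, mem_edgeImage,
    Function.Embedding.coe_subtype]
  constructor
  · rintro ⟨e, ⟨g, hg, h⟩, rfl⟩
    exact ⟨g, hg, h⟩
  · rintro ⟨g, hg, rfl⟩
    exact ⟨⟨_, fun h => G.not_isDiag_of_mem_edgeSet hg ((Sym2.isDiag_map ψ.injective).1 h)⟩,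
      ⟨g, hg, rfl⟩, rfl⟩

lemma NG_eq_sum_monom (x : Config n) :
    NG G x = ∑ ψ : Fin m ↪ Fin n, monom (edgeImage G ψ) x := by
  classical
  refine Finset.sum_congr rfl fun ψ _ => ?_
  have h1 : ∀ a b, (@ite ℝ (G.Adj a b) (Classical.propDecidable _) (edgeInd x (ψ a) (ψ b)) 1)
      = if G.Adj a b → edgeVal x (ψ a) (ψ b) = true then 1 else 0 := by
    intro a b
    by_cases h : G.Adj a b <;> simp [h, edgeInd]
  simp only [h1, Finset.prod_boole, Finset.mem_univ, true_implies]
  rw [monom_eq_ite]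
  congr 1
  rw [eq_iff_iff]
  constructor
  · rintro h ⟨e, he⟩ hmem
    obtain ⟨g, hg, hge⟩ := mem_edgeImage.1 hmem
    induction g using Sym2.ind with
    | _ a b =>
      have h2 := h a b (G.mem_edgeSet.1 hg)
      simp only [Sym2.map_mk] at hge
      subst hge
      rwa [edgeVal, dif_neg he] at h2
  · intro h a b hab
    have hd : ¬ (s(ψ a, ψ b) : Sym2 (Fin n)).IsDiag := by
      simpa using hab.ne
    rw [edgeVal, dif_neg hd]
    exact h _ (mem_edgeImage.2 ⟨s(a, b), G.mem_edgeSet.2 hab, by simp⟩)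

open scoped Classical in
/-- The number of embeddings of `G` using all the edges in `A`. -/
noncomputable def copyCount (A : Finset (EdgeSet n)) : ℕ :=
  Finset.card {ψ : Fin m ↪ Fin n | A ⊆ edgeImage G ψ}

lemma copyCount_eq (A : Finset (EdgeSet n)) {P : (Fin m ↪ Fin n) → Prop} [DecidablePred P]
    (h : ∀ ψ, P ψ ↔ A ⊆ edgeImage G ψ) : copyCount G A = Finset.card {ψ | P ψ} := by
  unfold copyCount
  congr 1
  ext ψ
  simp [h]

lemma exists_perm_map_eq (a b : EdgeSet n) :
    ∃ σ : Equiv.Perm (Fin n), Sym2.map σ a.1 = b.1 := by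
  obtain ⟨a, ha⟩ := a
  obtain ⟨b, hb⟩ := b
  induction a using Sym2.ind with
  | _ u v =>
    induction b using Sym2.ind with
    | _ u' v' =>
      have huv : u ≠ v := by simpa using ha
      have huv' : u' ≠ v' := by simpa using hb
      refine ⟨(Equiv.swap u u').trans (Equiv.swap (Equiv.swap u u' v) v'), ?_⟩
      have h1 : u' ≠ Equiv.swap u u' v := by
        intro h
        have := (Equiv.swap u u').injective ((Equiv.swap_apply_left u u').trans h)
        exact huv this
      simp [Equiv.swap_apply_of_ne_of_ne h1 huv']

lemma copyCount_singleton_eq (a b : EdgeSet n) : copyCount G {a} = copyCount G {b} := by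
  classical
  obtain ⟨σ, hσ⟩ := exists_perm_map_eq a b
  refine Finset.card_equiv ((Equiv.refl _).embeddingCongr σ) fun ψ => ?_
  simp only [Finset.mem_filter, Finset.mem_univ, true_and, Finset.singleton_subset_iff,
    mem_edgeImage]
  refine exists_congr fun g => and_congr_right fun _ => ?_
  have e : Sym2.map ((Equiv.refl _).embeddingCongr σ ψ) g = Sym2.map σ (Sym2.map ψ g) := by
    rw [Sym2.map_map]; rfl
  rw [e, ← hσ, (Sym2.map.injective σ.injective).eq_iff]

lemma copyCount_singleton_mul (a : EdgeSet n) :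
    copyCount G {a} * n.choose 2 = numEdges G * n.descFactorial m := by
  classical
  have h := Finset.sum_card_bipartiteAbove_eq_sum_card_bipartiteBelow
    (fun (e : EdgeSet n) (ψ : Fin m ↪ Fin n) => e ∈ edgeImage G ψ)
    (s := Finset.univ) (t := Finset.univ)
  have h1 : ∀ e : EdgeSet n, (Finset.univ.bipartiteAbove
      (fun (e : EdgeSet n) (ψ : Fin m ↪ Fin n) => e ∈ edgeImage G ψ) e).card
        = copyCount G {a} := fun e => by
    rw [copyCount_singleton_eq G a e, copyCount, Finset.bipartiteAbove]
    simp only [Finset.singleton_subset_iff]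
  have h2 : ∀ ψ : Fin m ↪ Fin n, (Finset.univ.bipartiteBelow
      (fun (e : EdgeSet n) (ψ : Fin m ↪ Fin n) => e ∈ edgeImage G ψ) ψ).card
        = numEdges G := fun ψ => by
    rw [← card_edgeImage G ψ, Finset.bipartiteBelow, Finset.filter_mem_eq_inter,
      Finset.univ_inter]
  simp only [h1, h2, Finset.sum_const, Finset.card_univ, smul_eq_mul, Fintype.card_embedding_eq,
    Fintype.card_fin] at h
  rw [Sym2.card_subtype_not_diag, Fintype.card_fin] at h
  linarith

lemma numEdges_eq_zero_of_lt_two (hm : m < 2) : numEdges G = 0 := by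
  have : Subsingleton (Fin m) := Fin.subsingleton_iff_le_one.2 (by omega)
  rw [numEdges, Set.ncard_eq_zero, Subsingleton.elim G ⊥, SimpleGraph.edgeSet_bot]

lemma copyCount_div_bounds (a : EdgeSet n) :
    2 * (numEdges G : ℝ) - 2 * numEdges G * m ^ 2 / n
        ≤ copyCount G {a} / (n : ℝ) ^ (m - 2) ∧
      copyCount G {a} / (n : ℝ) ^ (m - 2) ≤ 2 * numEdges G := by
  have hmul := copyCount_singleton_mul G a
  have hn : 2 ≤ n := by
    by_contra h
    have : Subsingleton (Fin n) := Fin.subsingleton_iff_le_one.2 (by omega)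
    obtain ⟨z, hz⟩ := a
    induction z using Sym2.ind with
    | _ u v => exact hz (Sym2.mk_isDiag_iff.2 (Subsingleton.elim u v))
  obtain ⟨k, rfl⟩ : ∃ k, n = k + 2 := ⟨n - 2, by omega⟩
  have hchoose : (k + 2).choose 2 * 2 = (k + 2) * (k + 1) := by
    rw [Nat.choose_two_right, Nat.div_mul_cancel (Nat.even_mul_pred_self _).two_dvd]
    rfl
  have hpos : 0 < (k + 2).choose 2 := Nat.choose_pos (by omega)
  rcases lt_or_ge m 2 with hm | hm
  · rw [numEdges_eq_zero_of_lt_two G hm, zero_mul] at hmul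
    rw [numEdges_eq_zero_of_lt_two G hm, (Nat.mul_eq_zero.1 hmul).resolve_right hpos.ne']
    simp
  obtain ⟨l, rfl⟩ : ∃ l, m = l + 2 := ⟨m - 2, by omega⟩
  have hcount : copyCount G {a} = 2 * numEdges G * k.descFactorial l := by
    rw [Nat.succ_descFactorial_succ (k + 1), Nat.succ_descFactorial_succ k] at hmul
    refine Nat.eq_of_mul_eq_mul_right hpos ?_
    have h2 : 2 * (copyCount G {a} * (k + 2).choose 2)
        = 2 * (2 * numEdges G * k.descFactorial l * (k + 2).choose 2) := by
      calc 2 * (copyCount G {a} * (k + 2).choose 2)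
          = 2 * numEdges G * k.descFactorial l * ((k + 2) * (k + 1)) := by rw [hmul]; ring
        _ = _ := by rw [← hchoose]; ring
    omega
  rw [hcount, Nat.add_sub_cancel]
  have hn0 : (0 : ℝ) < (k + 2 : ℕ) := by positivity
  have hE : (0 : ℝ) ≤ 2 * numEdges G := by positivity
  have hratio : (((2 * numEdges G * k.descFactorial l : ℕ) : ℝ)) / ((k + 2 : ℕ) : ℝ) ^ l
      = 2 * numEdges G * ((k.descFactorial l : ℝ) / ((k + 2 : ℕ) : ℝ) ^ l) := by
    push_cast; ring
  rw [hratio]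
  constructor
  · have key : 1 - ((l + 2 : ℕ) : ℝ) ^ 2 / (k + 2 : ℕ)
        ≤ (k.descFactorial l : ℝ) / ((k + 2 : ℕ) : ℝ) ^ l := by
      rcases le_or_gt ((k + 2 : ℕ) : ℝ) (((l + 2 : ℕ) : ℝ) ^ 2) with h | h
      · have h1 : 1 ≤ ((l + 2 : ℕ) : ℝ) ^ 2 / (k + 2 : ℕ) := (one_le_div hn0).2 h
        have h2 : 0 ≤ (k.descFactorial l : ℝ) / ((k + 2 : ℕ) : ℝ) ^ l := by positivity
        linarith
      · have hlk : (l + 2) ^ 2 < k + 2 := by exact_mod_cast h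
        have hlk' : l + 2 ≤ k + 2 := by nlinarith
        have h1 : ((k + 2 : ℕ) - (l + 2 : ℕ) : ℝ) ^ l ≤ k.descFactorial l := by
          rw [← Nat.cast_sub hlk', ← Nat.cast_pow, Nat.cast_le]
          exact (Nat.pow_le_pow_left (by omega) l).trans (Nat.pow_sub_le_descFactorial k l)
        rw [le_div_iff₀ (by positivity)]
        refine le_trans ?_ h1
        have h2 : ((k + 2 : ℕ) - (l + 2 : ℕ) : ℝ)
            = (1 + -(((l + 2 : ℕ) : ℝ) / (k + 2 : ℕ))) * (k + 2 : ℕ) := by field_simp; ring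
        rw [h2, mul_pow]
        refine mul_le_mul_of_nonneg_right ?_ (by positivity)
        have h3 : ((l + 2 : ℕ) : ℝ) / (k + 2 : ℕ) ≤ 1 :=
          (div_le_one hn0).2 (Nat.cast_le.2 hlk')
        refine le_trans ?_ (one_add_mul_le_pow (by linarith) l)
        have h4 : (l : ℝ) * (((l + 2 : ℕ) : ℝ) / (k + 2 : ℕ))
            ≤ ((l + 2 : ℕ) : ℝ) ^ 2 / (k + 2 : ℕ) := by
          rw [sq, mul_div_assoc]
          refine mul_le_mul_of_nonneg_right ?_ (by positivity)
          exact Nat.cast_le.2 (by omega)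
        linarith
    have := mul_le_mul_of_nonneg_left key hE
    refine le_trans (le_of_eq ?_) this
    ring
  · refine mul_le_of_le_one_right hE ((div_le_one (by positivity)).2 ?_)
    rw [← Nat.cast_pow, Nat.cast_le]
    exact (Nat.descFactorial_le_pow k l).trans (Nat.pow_le_pow_left (by omega) l)

lemma card_embedding_range_mul_le (m : ℕ) (U : Finset (Fin n)) [DecidablePred
    fun ψ : Fin m ↪ Fin n => ∀ u ∈ U, u ∈ Set.range ψ] :
    Finset.card {ψ : Fin m ↪ Fin n | ∀ u ∈ U, u ∈ Set.range ψ} * n ^ U.card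
      ≤ m ^ U.card * n ^ m := by
  classical
  have hch : ∀ p : {ψ : Fin m ↪ Fin n // ∀ u ∈ U, u ∈ Set.range ψ}, ∃ τ : U → Fin m,
      ∀ u : U, p.1 (τ u) = u := fun p =>
    ⟨fun u => (p.2 u.1 u.2).choose, fun u => (p.2 u.1 u.2).choose_spec⟩
  choose τ hτ using hch
  have hinj : ∀ p, Function.Injective (τ p) := fun p u v h => by
    have := congrArg p.1 h
    rw [hτ, hτ] at this
    exact Subtype.ext this
  have := Fintype.card_le_of_injective
    (fun q : {ψ : Fin m ↪ Fin n // ∀ u ∈ U, u ∈ Set.range ψ} × (U → Fin n) =>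
      ((τ q.1, Function.extend (τ q.1) q.2 q.1.1) : (U → Fin m) × (Fin m → Fin n))) ?_
  · simpa [Fintype.card_subtype] using this
  · rintro ⟨p, w⟩ ⟨p', w'⟩ h
    simp only [Prod.mk.injEq] at h
    obtain ⟨h1, h2⟩ := h
    have hw : w = w' := by
      funext u
      have h3 := congrFun h2 (τ p u)
      rw [(hinj p).extend_apply, h1, (hinj p').extend_apply] at h3
      exact h3
    have hp : p = p' := by
      refine Subtype.ext (Function.Embedding.ext fun v => ?_)
      by_cases hv : ∃ u, τ p u = v
      · obtain ⟨u, rfl⟩ := hv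
        rw [hτ, h1, hτ]
      · have h3 := congrFun h2 v
        rw [Function.extend_apply' _ _ _ hv, Function.extend_apply' _ _ _ (h1 ▸ hv)] at h3
        exact h3
    rw [hw, hp]

lemma copyCount_pair_le {a b : EdgeSet n} {k : ℕ} (hk : 2 ≤ k)
    (hU : k ≤ (a.1.toFinset ∪ b.1.toFinset).card) :
    copyCount G {a, b} / (n : ℝ) ^ (m - 2) ≤ (m : ℝ) ^ k / (n : ℝ) ^ (k - 2) := by
  classical
  rcases lt_or_ge m 2 with hm | hm
  · have h0 : copyCount G {a, b} = 0 := by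
      refine Finset.card_eq_zero.2 (Finset.filter_eq_empty_iff.2 fun ψ _ h => ?_)
      have h1 := Finset.card_pos.2 ⟨a, h (Finset.mem_insert_self a {b})⟩
      rw [card_edgeImage, numEdges_eq_zero_of_lt_two G hm] at h1
      exact absurd h1 (lt_irrefl 0)
    rw [h0, Nat.cast_zero, zero_div]
    positivity
  obtain ⟨U, hUsub, rfl⟩ := Finset.exists_subset_card_eq hU
  have hcount : copyCount G {a, b} * n ^ U.card ≤ m ^ U.card * n ^ m := by
    refine le_trans (Nat.mul_le_mul_right _ (Finset.card_le_card fun ψ hψ => ?_))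
      (card_embedding_range_mul_le m U)
    simp only [Finset.mem_filter, Finset.mem_univ, true_and] at hψ ⊢
    have hrange : ∀ e ∈ edgeImage G ψ, ∀ u ∈ e.1, u ∈ Set.range ψ := by
      intro e he u hu
      obtain ⟨g, -, hg⟩ := mem_edgeImage.1 he
      rw [← hg, Sym2.mem_map] at hu
      obtain ⟨v, -, hv⟩ := hu
      exact ⟨v, hv⟩
    intro u hu
    rcases Finset.mem_union.1 (hUsub hu) with h | h
    · exact hrange a (hψ (by simp)) u (Sym2.mem_toFinset.1 h)
    · exact hrange b (hψ (by simp)) u (Sym2.mem_toFinset.1 h)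
  have hn : 0 < n := by
    rcases Nat.eq_zero_or_pos n with rfl | h
    · obtain ⟨z, hz⟩ := a
      induction z using Sym2.ind with
      | _ u v => exact u.elim0
    · exact h
  have hn0 : (0 : ℝ) < n := Nat.cast_pos.2 hn
  rw [div_le_div_iff₀ (by positivity) (by positivity)]
  have h1 : (copyCount G {a, b} : ℝ) * (n : ℝ) ^ U.card ≤ (m : ℝ) ^ U.card * (n : ℝ) ^ m := by
    exact_mod_cast hcount
  have h2 : (n : ℝ) ^ U.card = (n : ℝ) ^ (U.card - 2) * n ^ 2 := by
    rw [← pow_add, Nat.sub_add_cancel hk]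
  have h3 : (n : ℝ) ^ m = (n : ℝ) ^ (m - 2) * n ^ 2 := by
    rw [← pow_add, Nat.sub_add_cancel hm]
  rw [h2, h3, ← mul_assoc, ← mul_assoc] at h1
  exact le_of_mul_le_mul_right h1 (by positivity)

lemma three_le_card_union {a b : EdgeSet n} (h : a ≠ b) :
    3 ≤ (a.1.toFinset ∪ b.1.toFinset).card := by
  by_contra hlt
  have ha := Sym2.card_toFinset_of_not_isDiag a.1 a.2
  have hb := Sym2.card_toFinset_of_not_isDiag b.1 b.2
  have h1 := Finset.eq_of_subset_of_card_le
    (Finset.subset_union_left (s₁ := a.1.toFinset) (s₂ := b.1.toFinset)) (by omega)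
  have h2 := Finset.eq_of_subset_of_card_le
    (Finset.subset_union_right (s₁ := a.1.toFinset) (s₂ := b.1.toFinset)) (by omega)
  refine h (Subtype.ext (Sym2.ext fun u => ?_))
  rw [← Sym2.mem_toFinset, ← Sym2.mem_toFinset, h1, ← h2]

lemma four_le_card_union {a b : EdgeSet n} (h : ¬ ShareVertex a b) :
    4 ≤ (a.1.toFinset ∪ b.1.toFinset).card := by
  rw [Finset.card_union_of_disjoint, Sym2.card_toFinset_of_not_isDiag a.1 a.2,
    Sym2.card_toFinset_of_not_isDiag b.1 b.2]
  refine Finset.disjoint_left.2 fun u hu hu' => h ⟨u, ?_, ?_⟩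
  · exact Sym2.mem_toFinset.1 hu
  · exact Sym2.mem_toFinset.1 hu'

end SubgraphCounts

section ExponentialRandomGraph

lemma lipschitzVec_of_abs_ddiff_le {n : ℕ} {v : EdgeSet n → ℝ} {f : Config n → ℝ}
    (h : ∀ a x, |ddiff a f x| ≤ v a) : LipschitzVec v f := by
  intro x y
  have key : ∀ s : Finset (EdgeSet n), |f x - f (s.piecewise y x)|
      ≤ ∑ a ∈ s, if x a ≠ y a then v a else 0 := by
    intro s
    induction s using Finset.induction_on with
    | empty => simp
    | insert a s ha ih =>
      rw [Finset.piecewise_insert, Finset.sum_insert ha, add_comm]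
      set z := s.piecewise y x with hz
      have hza : z a = x a := Finset.piecewise_eq_of_notMem _ _ _ ha
      have hself := Function.update_eq_self a z
      refine (abs_sub_le _ (f z) _).trans (add_le_add ih ?_)
      have h1 := h a z
      rw [ddiff] at h1
      rw [hza] at hself
      cases hx : x a <;> cases hy : y a <;> rw [hx] at hself <;> simp only [hself] at h1 ⊢
      · simp
      · rw [abs_sub_comm]
        simpa using h1
      · simpa using h1
      · simp
  simpa using key Finset.univ

variable {n s : ℕ} (V : Fin s → ℕ) (G : ∀ i, SimpleGraph (Fin (V i))) (β : Fin s → ℝ)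

/-- The coefficient in the Hamiltonian of an embedded copy of one of the graphs. -/
noncomputable def copyCoeff (n : ℕ) (j : Σ i, (Fin (V i) ↪ Fin n)) : ℝ :=
  β j.1 / (n : ℝ) ^ (V j.1 - 2)

/-- The edges of an embedded copy of one of the graphs. -/
noncomputable def copyEdges (n : ℕ) (j : Σ i, (Fin (V i) ↪ Fin n)) : Finset (EdgeSet n) :=
  edgeImage (G j.1) j.2

/-- The derivative of `Psi`. -/
noncomputable def PsiDeriv (q : ℝ) : ℝ :=
  ∑ i, 2 * β i * (numEdges (G i) : ℝ) *
    ((numEdges (G i) - 1 : ℕ) * q ^ (numEdges (G i) - 1 - 1))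

/-- A constant that controls all the subgraph counts. -/
noncomputable def countBound : ℝ :=
  1 + ∑ i, (numEdges (G i) : ℝ)
    + ∑ i, β i * (2 * numEdges (G i) * ((V i : ℝ) ^ 2 + 1) + (V i : ℝ) ^ 4)

lemma Hamiltonian_eq_energy :
    (Hamiltonian V G β : Config n → ℝ) = energy (copyCoeff V β n) (copyEdges V G n) := by
  funext x
  rw [Hamiltonian, energy, Fintype.sum_sigma]
  refine Finset.sum_congr rfl fun i _ => ?_
  rw [NG_eq_sum_monom, mul_div_right_comm, Finset.mul_sum]
  rfl

lemma dHam_eq_localField (e : EdgeSet n) :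
    dHam V G β e = localField (copyCoeff V β n) (copyEdges V G n) e := by
  funext x
  rw [← ddiff_energy, ← Hamiltonian_eq_energy]
  rfl

lemma prob_eq_mean_ind (w : Config n → ℝ) (A : Config n → Prop) :
    prob w A = mean w (ind A) := by
  refine Finset.sum_congr rfl fun x _ => ?_
  rw [ind]
  split_ifs <;> simp

lemma hasDerivAt_Psi (q : ℝ) : HasDerivAt (Psi V G β) (PsiDeriv V G β q) q :=
  HasDerivAt.fun_sum fun i _ => (hasDerivAt_pow (numEdges (G i) - 1) q).const_mul _

lemma Subcritical.meanFieldSubcritical (hβ : ∀ i, 0 < β i) {p : ℝ}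
    (h : Subcritical V G β p) : MeanFieldSubcritical (Psi V G β) (PsiDeriv V G β) p where
  continuous_profile := continuous_iff_continuousAt.2 fun q =>
    (hasDerivAt_Psi V G β q).continuousAt
  continuous_slope := by unfold PsiDeriv; fun_prop
  slope_nonneg q hq := Finset.sum_nonneg fun i _ => by
    have h1 := (hβ i).le
    have h2 := hq.1
    positivity
  fixed := h.1
  unique := h.2.1
  slope_lt := by
    have h1 := ((hasDerivAt_Phi (Psi V G β p)).comp p (hasDerivAt_Psi V G β p)).deriv
    have h2 := h.2.2
    have h3 : Phi (Psi V G β p) = p := h.1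
    rw [h3] at h1
    exact h1 ▸ h2

lemma sum_copies_mem (a : EdgeSet n) (g : Fin s → ℝ) :
    ∑ j with a ∈ copyEdges V G n j, copyCoeff V β n j * g j.1
      = ∑ i, β i * (copyCount (G i) {a} / (n : ℝ) ^ (V i - 2)) * g i := by
  rw [Finset.sum_filter, Fintype.sum_sigma]
  refine Finset.sum_congr rfl fun i _ => ?_
  rw [← Finset.sum_filter, copyCount_eq (G i) {a}
    (P := fun ψ => a ∈ copyEdges V G n ⟨i, ψ⟩) (fun ψ => by simp [copyEdges])]
  simp only [copyCoeff, Finset.sum_const, nsmul_eq_mul]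
  ring

lemma infl_copies (a b : EdgeSet n) :
    infl (copyCoeff V β n) (copyEdges V G n) a b
      = ∑ i, β i * (copyCount (G i) {a, b} / (n : ℝ) ^ (V i - 2)) := by
  rw [infl, Finset.sum_filter, Fintype.sum_sigma]
  refine Finset.sum_congr rfl fun i _ => ?_
  rw [← Finset.sum_filter, copyCount_eq (G i) {a, b}
    (P := fun ψ => a ∈ copyEdges V G n ⟨i, ψ⟩ ∧ b ∈ copyEdges V G n ⟨i, ψ⟩)
    (fun ψ => by simp [copyEdges, Finset.insert_subset_iff])]
  simp only [copyCoeff, Finset.sum_const, nsmul_eq_mul]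
  ring

variable {β}

lemma sum_le_countBound (hβ : ∀ i, 0 < β i) {g : Fin s → ℝ}
    (hg : ∀ i, g i ≤ 2 * numEdges (G i) * ((V i : ℝ) ^ 2 + 1) + (V i : ℝ) ^ 4) :
    ∑ i, β i * g i ≤ countBound V G β := by
  have h1 : ∑ i, β i * g i
      ≤ ∑ i, β i * (2 * numEdges (G i) * ((V i : ℝ) ^ 2 + 1) + (V i : ℝ) ^ 4) :=
    Finset.sum_le_sum fun i _ => mul_le_mul_of_nonneg_left (hg i) (hβ i).le
  have h2 : 0 ≤ ∑ i, (numEdges (G i) : ℝ) := by positivity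
  unfold countBound
  linarith

lemma countBound_pos (hβ : ∀ i, 0 < β i) : 0 < countBound V G β := by
  have h1 : 0 ≤ ∑ i, β i * (2 * numEdges (G i) * ((V i : ℝ) ^ 2 + 1) + (V i : ℝ) ^ 4) :=
    Finset.sum_nonneg fun i _ => mul_nonneg (hβ i).le (by positivity)
  unfold countBound
  positivity

lemma infl_copies_le (hβ : ∀ i, 0 < β i) {a b : EdgeSet n} {k : ℕ} (hk : 2 ≤ k) (hk4 : k ≤ 4)
    (hU : k ≤ (a.1.toFinset ∪ b.1.toFinset).card) :
    infl (copyCoeff V β n) (copyEdges V G n) a b ≤ countBound V G β / (n : ℝ) ^ (k - 2) := by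
  have h1 : ∑ i, β i * (V i : ℝ) ^ k ≤ countBound V G β := by
    refine sum_le_countBound V G hβ fun i => ?_
    have h2 : (V i : ℝ) ^ k ≤ (V i : ℝ) ^ 4 := by
      rw [← Nat.cast_pow, ← Nat.cast_pow, Nat.cast_le]
      rcases Nat.eq_zero_or_pos (V i) with h | h
      · rw [h, zero_pow (by omega)]
        exact Nat.zero_le _
      · exact Nat.pow_le_pow_right h hk4
    have h3 : 0 ≤ 2 * (numEdges (G i) : ℝ) * ((V i : ℝ) ^ 2 + 1) := by positivity
    linarith
  rw [infl_copies]
  calc ∑ i, β i * (copyCount (G i) {a, b} / (n : ℝ) ^ (V i - 2))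
      ≤ ∑ i, β i * ((V i : ℝ) ^ k / (n : ℝ) ^ (k - 2)) :=
        Finset.sum_le_sum fun i _ =>
          mul_le_mul_of_nonneg_left (copyCount_pair_le (G i) hk hU) (hβ i).le
    _ = (∑ i, β i * (V i : ℝ) ^ k) / (n : ℝ) ^ (k - 2) := by
        rw [Finset.sum_div]
        exact Finset.sum_congr rfl fun i _ => (mul_div_assoc _ _ _).symm
    _ ≤ _ := div_le_div_of_nonneg_right h1 (by positivity)

lemma sum_copies_mem_le (hβ : ∀ i, 0 < β i) (a : EdgeSet n) {g : Fin s → ℝ} (hg : ∀ i, 0 ≤ g i) :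
    ∑ j with a ∈ copyEdges V G n j, copyCoeff V β n j * g j.1
      ≤ ∑ i, 2 * β i * (numEdges (G i) : ℝ) * g i := by
  rw [sum_copies_mem]
  refine Finset.sum_le_sum fun i _ => mul_le_mul_of_nonneg_right ?_ (hg i)
  calc β i * (copyCount (G i) {a} / (n : ℝ) ^ (V i - 2)) ≤ β i * (2 * numEdges (G i)) :=
        mul_le_mul_of_nonneg_left (copyCount_div_bounds (G i) a).2 (hβ i).le
    _ = _ := by ring

lemma card_copyEdges (j : Σ i, (Fin (V i) ↪ Fin n)) :
    (copyEdges V G n j).card = numEdges (G j.1) :=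
  card_edgeImage (G j.1) j.2

lemma regular_copies (hβ : ∀ i, 0 < β i) :
    Regular (copyCoeff V β n) (copyEdges V G n) (Psi V G β) (PsiDeriv V G β)
      (countBound V G β) n where
  coeff_nonneg j := div_nonneg (hβ _).le (by positivity)
  card_le j := by
    rw [card_copyEdges]
    have h1 := Finset.single_le_sum (f := fun i => (numEdges (G i) : ℝ))
      (fun i _ => Nat.cast_nonneg _) (Finset.mem_univ j.1)
    have h2 : 0 ≤ ∑ i, β i * (2 * numEdges (G i) * ((V i : ℝ) ^ 2 + 1) + (V i : ℝ) ^ 4) :=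
      Finset.sum_nonneg fun i _ => mul_nonneg (hβ i).le (by positivity)
    unfold countBound
    linarith
  card_index_le := by
    rw [Sym2.card_subtype_not_diag, Fintype.card_fin, ← Nat.cast_pow, Nat.cast_le]
    exact Nat.choose_le_pow n 2
  weight_le a := by
    have h1 := sum_copies_mem_le V G hβ a (g := fun _ => 1) fun _ => zero_le_one
    simp only [mul_one] at h1
    simp only [infl, and_self]
    refine h1.trans ?_
    have h2 : ∑ i, 2 * β i * (numEdges (G i) : ℝ) = ∑ i, β i * (2 * numEdges (G i)) :=
      Finset.sum_congr rfl fun i _ => by ring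
    rw [h2]
    refine sum_le_countBound V G hβ fun i => ?_
    have h3 : 0 ≤ 2 * (numEdges (G i) : ℝ) * (V i : ℝ) ^ 2 + (V i : ℝ) ^ 4 := by positivity
    linarith
  infl_le a b hab := by
    simpa using infl_copies_le V G hβ (k := 3) (by omega) (by omega) (three_le_card_union hab)
  profile_le a q hq := by
    simp only [card_copyEdges]
    exact sum_copies_mem_le V G hβ a (g := fun i => q ^ (numEdges (G i) - 1))
      fun i => pow_nonneg hq.1 _
  le_profile a q hq := by
    simp only [card_copyEdges]
    rw [sum_copies_mem V G β a fun i => q ^ (numEdges (G i) - 1)]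
    have h1 : ∑ i, β i * (2 * numEdges (G i) * (V i : ℝ) ^ 2) ≤ countBound V G β := by
      refine sum_le_countBound V G hβ fun i => ?_
      have h3 : 0 ≤ 2 * (numEdges (G i) : ℝ) + (V i : ℝ) ^ 4 := by positivity
      linarith
    have h2 := div_le_div_of_nonneg_right h1 (Nat.cast_nonneg (α := ℝ) n)
    refine (sub_le_sub_left h2 _).trans ?_
    rw [Psi, Finset.sum_div, ← Finset.sum_sub_distrib]
    refine Finset.sum_le_sum fun i _ => ?_
    have h3 := mul_le_mul_of_nonneg_left (copyCount_div_bounds (G i) a).1 (hβ i).le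
    have h4 := mul_le_mul_of_nonneg_right h3 (pow_nonneg hq.1 (numEdges (G i) - 1))
    refine le_trans ?_ h4
    have h5 : 0 ≤ β i * (2 * numEdges (G i) * (V i : ℝ) ^ 2) / n :=
      div_nonneg (mul_nonneg (hβ i).le (by positivity)) (by positivity)
    have h6 := mul_le_of_le_one_right h5 (pow_le_one₀ hq.1 hq.2 (n := numEdges (G i) - 1))
    calc _ ≤ 2 * β i * numEdges (G i) * q ^ (numEdges (G i) - 1)
          - β i * (2 * numEdges (G i) * (V i : ℝ) ^ 2) / n * q ^ (numEdges (G i) - 1) :=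
          sub_le_sub_left h6 _
      _ = _ := by ring
  slope_le a q hq := by
    simp only [card_copyEdges]
    exact sum_copies_mem_le V G hβ a
      (g := fun i => (numEdges (G i) - 1 : ℕ) * q ^ (numEdges (G i) - 1 - 1))
      fun i => mul_nonneg (Nat.cast_nonneg _) (pow_nonneg hq.1 _)

end ExponentialRandomGraph

/-- **(Equation (641): Lipschitz structure and concentration of `∂_e H`).**
For an edge `e`, the function `x ↦ ∂_e H(x)` is Lipschitz with a vector `v` whose
entries are `O(1/n²)` at edges vertex-disjoint from `e` and `O(1/n)` at edges sharing
a vertex with `e`, so that `‖v‖₁ = O(1)` and `‖v‖_∞ = O(1/n)`; consequently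
`ℙ(|∂_e H(X) - 𝔼 ∂_e H(X)| > ε) ≤ 2 exp(-c n ε²)`. -/
theorem dHam_lipschitz_concentration {s : ℕ} (V : Fin s → ℕ)
    (G : ∀ i, SimpleGraph (Fin (V i))) (β : Fin s → ℝ) (hβ : ∀ i, 0 < β i)
    (p : ℝ) (hsub : Subcritical V G β p) :
    ∃ C c : ℝ, 0 < C ∧ 0 < c ∧ ∃ N : ℕ, ∀ n : ℕ, N ≤ n → ∀ e : EdgeSet n,
      (∃ v : EdgeSet n → ℝ, (∀ f, 0 ≤ v f) ∧
        (∀ f : EdgeSet n, ¬ ShareVertex e f → v f ≤ C / (n : ℝ) ^ 2) ∧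
        (∀ f : EdgeSet n, ShareVertex e f → v f ≤ C / (n : ℝ)) ∧
        LipschitzVec v (dHam V G β e) ∧
        (∑ f : EdgeSet n, v f) ≤ C ∧
        (⨆ f : EdgeSet n, v f) ≤ C / (n : ℝ)) ∧
      ∀ ε : ℝ, 0 < ε →
        prob (ergmProb V G β)
            (fun x => ε <
              |dHam V G β e x - expect (ergmProb V G β) (dHam V G β e)|) ≤
          2 * Real.exp (-c * (n : ℝ) * ε ^ 2) := by
  have hK := countBound_pos V G hβ
  set K := countBound V G β
  obtain ⟨k, hk, N, hN⟩ := (hsub.meanFieldSubcritical V G β hβ).concentration hK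
  refine ⟨K + K ^ 2, k, by positivity, hk, ⌈N⌉₊, fun n hn e => ?_⟩
  have H := regular_copies V G hβ (n := n)
  have hinfl := infl_nonneg (T := copyEdges V G n) H.coeff_nonneg e
  set v : EdgeSet n → ℝ :=
    fun f => if f = e then 0 else infl (copyCoeff V β n) (copyEdges V G n) e f with hv
  have hv_le : ∀ f, v f ≤ K / n := by
    intro f
    simp only [hv]
    split_ifs with hf
    · positivity
    · exact H.infl_le e f (Ne.symm hf)
  have hK_le : K ≤ K + K ^ 2 := by nlinarith
  have hv_le' : ∀ f, v f ≤ (K + K ^ 2) / n := fun f =>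
    (hv_le f).trans (div_le_div_of_nonneg_right hK_le (Nat.cast_nonneg n))
  refine ⟨⟨v, fun f => ?_, fun f hf => ?_, fun f _ => hv_le' f, ?_, ?_, ?_⟩, fun ε hε => ?_⟩
  · simp only [hv]
    split_ifs
    exacts [le_rfl, hinfl f]
  · simp only [hv]
    split_ifs
    · positivity
    · exact (infl_copies_le V G hβ (by omega) le_rfl (four_le_card_union hf)).trans
        (div_le_div_of_nonneg_right hK_le (by positivity))
  · rw [dHam_eq_localField]
    refine lipschitzVec_of_abs_ddiff_le fun a x => ?_
    rw [abs_of_nonneg (ddiff_localField_nonneg H.coeff_nonneg e a x)]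
    simp only [hv]
    split_ifs with ha
    · rw [ha, ddiff_localField_self]
    · exact ddiff_localField_le H.coeff_nonneg x
  · refine le_trans ?_ ((H.sum_infl_le e).trans (le_add_of_nonneg_left hK.le))
    refine Finset.sum_le_sum fun f _ => ?_
    simp only [hv]
    split_ifs
    exacts [hinfl f, le_rfl]
  · have : Nonempty (EdgeSet n) := ⟨e⟩
    exact ciSup_le hv_le'
  · rw [prob_eq_mean_ind, dHam_eq_localField]
    have hw : (ergmProb V G β : Config n → ℝ)
        = gibbs (energy (copyCoeff V β n) (copyEdges V G n)) := by
      rw [← Hamiltonian_eq_energy]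
      rfl
    rw [hw]
    exact hN n (Nat.ceil_le.1 hn) _ _ _ _ H e ε hε

end ERGM
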